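/- Let K ∈ ℝ, N ∈ [1,∞) and let (X,d,m) be a CD*(K,N) metric measure space having the good transport property (GT). Then for every x ∈ X the following holds: for m-almost every y ∈ X there is exactly one geodesic gamma ∈ Geo(X) with gamma_0 = y and gamma_1 = x. -/

import Mathlib

open MeasureTheory Metric Set unitInterval ENNReal NNReal

noncomputable section

variable {X : Type*} [MetricSpace X]

/-- A constant speed minimizing geodesic parametrized on `[0,1]`. -/
def IsUnitGeodesic (γ : C(unitInterval, X)) : Prop :=
  ∀ s t : unitInterval, dist (γ s) (γ t) = |(s : ℝ) - (t : ℝ)| * dist (γ 0) (γ 1)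

/-- The space of constant speed minimizing geodesics, with the sup distance. -/
def Geo (X : Type*) [MetricSpace X] : Type _ :=
  { γ : C(unitInterval, X) // IsUnitGeodesic γ }

instance : MetricSpace (Geo X) := Subtype.metricSpace
instance : MeasurableSpace (Geo X) := borel _
instance : BorelSpace (Geo X) := ⟨rfl⟩

/-- Evaluation map `e_t`. -/
def eval (t : unitInterval) (γ : Geo X) : X := γ.1 t

/-- `(X,d)` is a geodesic space: any two points are joined by a geodesic. -/
def IsGeodesicSpace (X : Type*) [MetricSpace X] : Prop :=
  ∀ x y : X, ∃ γ : Geo X, eval 0 γ = x ∧ eval 1 γ = y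

/-- The (topological) support of a measure. -/
def measSupport {Y : Type*} [TopologicalSpace Y] [MeasurableSpace Y] (μ : Measure Y) : Set Y :=
  {y | ∀ U ∈ nhds y, 0 < μ U}

variable [MeasurableSpace X]

/-- Finite second moment. -/
def HasFiniteSecondMoment (μ : Measure X) : Prop :=
  ∃ x₀ : X, ∫⁻ x, ENNReal.ofReal (dist x x₀ ^ 2) ∂μ ≠ ⊤

/-- The transport cost of a plan on the space of geodesics. -/
def transportCost (π : Measure (Geo X)) : ℝ≥0∞ :=
  ∫⁻ γ, ENNReal.ofReal (dist (eval 0 γ) (eval 1 γ) ^ 2) ∂π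

/-- `π ∈ OptGeo(μ,ν)`: an optimal geodesic plan from `μ` to `ν`. -/
def IsOptGeo (μ ν : Measure X) (π : Measure (Geo X)) : Prop :=
  IsProbabilityMeasure π ∧ π.map (eval 0) = μ ∧ π.map (eval 1) = ν ∧
    ∀ π' : Measure (Geo X), IsProbabilityMeasure π' →
      π'.map (eval 0) = μ → π'.map (eval 1) = ν →
      transportCost π ≤ transportCost π'

/-- The distortion coefficients `σ_{K,N}^{(t)}(θ)`. -/
def sigmaCoeff (K N t θ : ℝ) : ℝ≥0∞ :=
  if N * Real.pi ^ 2 ≤ K * θ ^ 2 then ⊤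
  else if 0 < K * θ ^ 2 then
    ENNReal.ofReal (Real.sin (t * θ * Real.sqrt (K / N)) / Real.sin (θ * Real.sqrt (K / N)))
  else if K * θ ^ 2 = 0 then ENNReal.ofReal t
  else ENNReal.ofReal (Real.sinh (t * θ * Real.sqrt (-K / N)) / Real.sinh (θ * Real.sqrt (-K / N)))

/-- The distortion coefficients `τ_{K,N}^{(t)}(θ)`. -/
def tauCoeff (K N t θ : ℝ) : ℝ≥0∞ :=
  if N = 1 then
    (if K ≤ 0 then ENNReal.ofReal t else if θ = 0 then ENNReal.ofReal t else ⊤)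
  else ENNReal.ofReal t ^ (1 / N) * sigmaCoeff K (N - 1) t θ ^ ((N - 1) / N)

/-- The (reduced) curvature dimension condition `CD*(K,N)`. -/
def IsCDStar (K N : ℝ) (m : Measure X) : Prop :=
  ∀ μ₀ μ₁ : Measure X, IsProbabilityMeasure μ₀ → IsProbabilityMeasure μ₁ →
    (∃ s : Set X, Bornology.IsBounded s ∧ μ₀ sᶜ = 0 ∧ μ₁ sᶜ = 0) →
    ∃ π : Measure (Geo X), IsOptGeo μ₀ μ₁ π ∧
      ∀ t : unitInterval, ∀ N' : ℝ, N ≤ N' →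
        ∫⁻ γ, (sigmaCoeff K N' (1 - (t : ℝ)) (dist (eval 0 γ) (eval 1 γ)) *
                 ((π.map (eval 0)).rnDeriv m (eval 0 γ)) ^ (-(1 / N')) +
               sigmaCoeff K N' (t : ℝ) (dist (eval 0 γ) (eval 1 γ)) *
                 ((π.map (eval 1)).rnDeriv m (eval 1 γ)) ^ (-(1 / N'))) ∂π
          ≤ ∫⁻ x, ((π.map (eval t)).rnDeriv m x) ^ (1 - 1 / N') ∂m

/-- The good transport property (GT): between absolutely continuous measures in `P₂(X)` there is
a unique optimal geodesic plan, and it is induced by a map from every intermediate time. -/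
def GoodTransport (m : Measure X) : Prop :=
  ∀ μ ν : Measure X, IsProbabilityMeasure μ → IsProbabilityMeasure ν →
    HasFiniteSecondMoment μ → HasFiniteSecondMoment ν → μ ≪ m → ν ≪ m →
    (∃! π : Measure (Geo X), IsOptGeo μ ν π) ∧
    ∀ π : Measure (Geo X), IsOptGeo μ ν π → ∀ t : unitInterval,
      ∃ T : X → Geo X, Measurable T ∧ π = (π.map (eval t)).map T

/-- `c`-concavity (with `c = d²/2`) for functions with values in `ℝ ∪ {-∞}`. -/
def cConcave (φ : X → EReal) : Prop :=
  (∃ x, φ x ≠ ⊥) ∧ (∀ x, φ x ≠ ⊤) ∧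
    ∃ ψ : X → EReal, (∀ y, ψ y ≠ ⊤) ∧
      ∀ x, φ x = ⨅ y, ((dist x y ^ 2 / 2 : ℝ) : EReal) - ψ y

/-- The `c`-transform `φᶜ`. -/
def cTransform (φ : X → EReal) : X → EReal :=
  fun y => ⨅ x, ((dist x y ^ 2 / 2 : ℝ) : EReal) - φ x

/-- The `c`-superdifferential `∂ᶜφ`. -/
def cSuperdiff (φ : X → EReal) : Set (X × X) :=
  {p | φ p.1 + cTransform φ p.2 = ((dist p.1 p.2 ^ 2 / 2 : ℝ) : EReal)}

/-- Kantorovich potential from `μ` to `ν`. -/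
def IsKantorovichPotential (μ ν : Measure X) (φ : X → EReal) : Prop :=
  cConcave φ ∧ ∀ π : Measure (Geo X), IsOptGeo μ ν π →
    measSupport (π.map (fun γ => (eval 0 γ, eval 1 γ))) ⊆ cSuperdiff φ


/-! ### General measure theory -/

lemma aux_common {Y : Type*} [MeasurableSpace Y] (α₁ α₂ : Measure Y) [IsFiniteMeasure α₁]
    [SigmaFinite α₂] (h : ¬ α₁ ⟂ₘ α₂) :
    ∃ l : Measure Y, IsProbabilityMeasure l ∧ l ≪ α₁ ∧ l ≪ α₂ := by
  set w := α₂.withDensity (α₁.rnDeriv α₂) with hw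
  have hw0 : w ≠ 0 := fun h0 => h ((Measure.withDensity_rnDeriv_eq_zero α₁ α₂).1 h0)
  have : IsFiniteMeasure w := isFiniteMeasure_of_le α₁ (Measure.withDensity_rnDeriv_le α₁ α₂)
  have : NeZero w := ⟨hw0⟩
  refine ⟨(w univ)⁻¹ • w, inferInstance, ?_, ?_⟩
  · exact (Measure.smul_absolutelyContinuous).trans
      (Measure.absolutelyContinuous_of_le (Measure.withDensity_rnDeriv_le α₁ α₂))
  · exact (Measure.smul_absolutelyContinuous).trans (withDensity_absolutelyContinuous _ _)

lemma aux_lift {Z Y : Type*} [MeasurableSpace Y] [MeasurableSpace Z] (π : Measure Z)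
    [IsFiniteMeasure π] (f : Z → Y) (hf : Measurable f) (l : Measure Y) [IsProbabilityMeasure l]
    (h : l ≪ π.map f) :
    ∃ π' : Measure Z, IsProbabilityMeasure π' ∧ π' ≪ π ∧ π'.map f = l := by
  set g := l.rnDeriv (π.map f) with hg
  have hgm : Measurable g := Measure.measurable_rnDeriv _ _
  have key : (π.withDensity (g ∘ f)).map f = l := by
    conv_rhs => rw [← Measure.withDensity_rnDeriv_eq l (π.map f) h]
    ext s hs
    rw [Measure.map_apply hf hs, withDensity_apply _ (hf hs), withDensity_apply _ hs,
      setLIntegral_map hs hgm hf]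
    rfl
  refine ⟨π.withDensity (g ∘ f), ⟨?_⟩, withDensity_absolutelyContinuous _ _, key⟩
  have : (π.withDensity (g ∘ f)).map f univ = 1 := by rw [key]; simp
  rwa [Measure.map_apply hf MeasurableSet.univ, preimage_univ] at this

/-- Internal-energy functional. -/
def Ufun {Y : Type*} [MeasurableSpace Y] (m : Measure Y) (p : ℝ) (μ : Measure Y) : ℝ≥0∞ :=
  ∫⁻ x, (μ.rnDeriv m x) ^ p ∂m

lemma Ufun_le {Y : Type*} [MeasurableSpace Y] (m : Measure Y) [SigmaFinite m] (p : ℝ) (hp : 0 < p)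
    (hp1 : p < 1) (μ : Measure Y) [IsProbabilityMeasure μ] (hμ : μ ≪ m)
    (A : Set Y) (hA : MeasurableSet A) (hμA : μ Aᶜ = 0) :
    Ufun m p μ ≤ (m A) ^ (1 - p) := by
  have hgm : Measurable (μ.rnDeriv m) := Measure.measurable_rnDeriv _ _
  have h0 : ∀ᵐ x ∂m, x ∈ Aᶜ → μ.rnDeriv m x = 0 := by
    have : ∫⁻ x in Aᶜ, μ.rnDeriv m x ∂m = 0 := by
      rw [Measure.setLIntegral_rnDeriv hμ]; exact hμA
    rw [lintegral_eq_zero_iff hgm] at this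
    exact (ae_restrict_iff' hA.compl).1 this
  have h1 : Ufun m p μ = ∫⁻ x, (μ.rnDeriv m x) ^ p * (A.indicator (fun _ => (1:ℝ≥0∞)) x) ^ (1 - p) ∂m := by
    refine lintegral_congr_ae ?_
    filter_upwards [h0] with x hx
    by_cases hxA : x ∈ A
    · simp [hxA]
    · simp [hx hxA, hp]
  rw [h1]
  refine (ENNReal.lintegral_mul_norm_pow_le hgm.aemeasurable
    (measurable_const.indicator hA).aemeasurable hp.le (by linarith) (by ring)).trans ?_
  rw [Measure.lintegral_rnDeriv hμ, lintegral_indicator hA]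
  simp

lemma Ufun_ne_zero {Y : Type*} [MeasurableSpace Y] (m : Measure Y) [SigmaFinite m] (p : ℝ)
    (hp : 0 < p) (μ : Measure Y) [IsProbabilityMeasure μ] (hμ : ¬ μ ⟂ₘ m) :
    Ufun m p μ ≠ 0 := by
  intro h
  apply hμ
  rw [← Measure.rnDeriv_eq_zero]
  rw [Ufun, lintegral_eq_zero_iff ((Measure.measurable_rnDeriv _ _).pow_const p)] at h
  filter_upwards [h] with x hx
  simpa [hp, hp.not_gt] using hx

lemma not_ms_of_Ufun {Y : Type*} [MeasurableSpace Y] (m : Measure Y) [SigmaFinite m] (p : ℝ)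
    (hp : 0 < p) (μ : Measure Y) [IsProbabilityMeasure μ] (h : Ufun m p μ ≠ 0) : ¬ μ ⟂ₘ m := by
  intro hμ
  apply h
  rw [← Measure.rnDeriv_eq_zero] at hμ
  rw [Ufun, lintegral_eq_zero_iff ((Measure.measurable_rnDeriv _ _).pow_const p)]
  filter_upwards [hμ] with x hx
  simp [hx, hp]

lemma aux_zero_of_null {Y : Type*} [MeasurableSpace Y] (m : Measure Y) [SigmaFinite m] 
    (μ : Measure Y) [IsProbabilityMeasure μ] (hμ : μ ≪ m)
    (A : Set Y) (hA : MeasurableSet A) (hμA : μ A = 0) :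
    ∀ᵐ x ∂m, x ∈ A → μ.rnDeriv m x = 0 := by
  have : ∫⁻ x in A, μ.rnDeriv m x ∂m = 0 := by
    rw [Measure.setLIntegral_rnDeriv hμ]; exact hμA
  rw [lintegral_eq_zero_iff (Measure.measurable_rnDeriv _ _)] at this
  exact (ae_restrict_iff' hA).1 this

lemma Ufun_mix {Y : Type*} [MeasurableSpace Y] (m : Measure Y) [SigmaFinite m] (p : ℝ) (hp : 0 < p)
    (μ ν : Measure Y) [IsProbabilityMeasure μ] [IsProbabilityMeasure ν] (hμ : μ ≪ m) (hν : ν ≪ m)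
    (h : μ ⟂ₘ ν) :
    Ufun m p ((2⁻¹ : ℝ≥0∞) • (μ + ν)) = (2⁻¹ : ℝ≥0∞) ^ p * (Ufun m p μ + Ufun m p ν) := by
  unfold Ufun
  rw [← lintegral_add_left ((Measure.measurable_rnDeriv _ _).pow_const p),
    ← lintegral_const_mul' _ _ (by simp)]
  refine lintegral_congr_ae ?_
  filter_upwards [Measure.rnDeriv_smul_left_of_ne_top (μ + ν) m (r := 2⁻¹) (by simp),
    Measure.rnDeriv_add μ ν m,
    aux_zero_of_null m μ hμ h.nullSet h.measurableSet_nullSet h.measure_nullSet,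
    aux_zero_of_null m ν hν h.nullSetᶜ h.measurableSet_nullSet.compl h.measure_compl_nullSet]
    with x h1 h2 h3 h4
  rw [h1, Pi.smul_apply, h2, Pi.add_apply, smul_eq_mul, ENNReal.mul_rpow_of_nonneg _ _ hp.le]
  by_cases hx : x ∈ h.nullSet
  · rw [h3 hx]; simp [hp]
  · rw [h4 hx]; simp [hp]

lemma Ufun_eq {Y : Type*} [MeasurableSpace Y] (m : Measure Y) [SigmaFinite m] (q : ℝ)
    (hq1 : q < 1) (μ : Measure Y) [IsProbabilityMeasure μ] (hμ : μ ≪ m) :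
    ∫⁻ x, (μ.rnDeriv m x) ^ (-q) ∂μ = Ufun m (1 - q) μ := by
  rw [← lintegral_rnDeriv_mul hμ ((Measure.measurable_rnDeriv _ _).pow_const _).aemeasurable]
  refine lintegral_congr_ae ?_
  filter_upwards [Measure.rnDeriv_lt_top μ m] with x hx
  rcases eq_or_ne (μ.rnDeriv m x) 0 with h | h
  · rw [h]; simp [hq1]
  · rw [sub_eq_add_neg, ENNReal.rpow_add _ _ h hx.ne, ENNReal.rpow_one]

lemma Ufun_unif {Y : Type*} [MeasurableSpace Y] (m : Measure Y) [SigmaFinite m] (p : ℝ) (hp : 0 < p)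
    (A : Set Y) (hA : MeasurableSet A) (h0 : m A ≠ 0) (h1 : m A ≠ ⊤) :
    Ufun m p ((m A)⁻¹ • m.restrict A) = (m A) ^ (1 - p) := by
  have : IsFiniteMeasure (m.restrict A) := ⟨by simpa using h1.lt_top⟩
  have : Ufun m p ((m A)⁻¹ • m.restrict A) = ∫⁻ x, A.indicator (fun _ => ((m A)⁻¹) ^ p) x ∂m := by
    refine lintegral_congr_ae ?_
    filter_upwards [Measure.rnDeriv_smul_left_of_ne_top (m.restrict A) m (r := (m A)⁻¹) (by simp [h0]),
      Measure.rnDeriv_restrict_self m hA] with x h2 h3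
    rw [h2, Pi.smul_apply, h3]
    by_cases hx : x ∈ A <;> simp [hx, hp]
  rw [this, lintegral_indicator hA, lintegral_const, Measure.restrict_apply_univ, mul_comm,
    sub_eq_add_neg, ENNReal.rpow_add _ _ h0 h1, ENNReal.rpow_one, ENNReal.inv_rpow, ENNReal.rpow_neg]

/-! ### Distortion coefficients -/

lemma sinh_bound (t a A : ℝ) (ht : 0 ≤ t) (ht1 : t ≤ 1) (ha : 0 < a) (haA : a ≤ A) :
    1 - (1 - t) * Real.cosh A ≤ Real.sinh (t * a) / Real.sinh a := by
  have hs : 0 < Real.sinh a := Real.sinh_pos_iff.2 ha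
  rw [le_div_iff₀ hs]
  have h1 : Real.sinh a - Real.sinh (t * a) ≤ (1 - t) * a * Real.cosh a := by
    have := Convex.image_sub_le_mul_sub_of_deriv_le (convex_Icc (t * a) a)
      (f := Real.sinh) Real.continuous_sinh.continuousOn Real.differentiable_sinh.differentiableOn
      (C := Real.cosh a) (by
        intro y hy
        rw [interior_Icc] at hy
        rw [Real.deriv_sinh, Real.cosh_le_cosh, abs_of_pos ha, abs_of_nonneg]
        · exact hy.2.le
        · nlinarith [hy.1, mul_nonneg ht ha.le]) (t * a) (by constructor <;> nlinarith) a
        (by constructor <;> nlinarith) (by nlinarith)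
    linarith
  have h2 : a ≤ Real.sinh a := Real.self_le_sinh_iff.2 ha.le
  have h3 : Real.cosh a ≤ Real.cosh A := by
    rw [Real.cosh_le_cosh, abs_of_pos ha, abs_of_pos (ha.trans_le haA)]; exact haA
  have h4 := Real.cosh_pos a
  have : (1 - t) * a * Real.cosh a ≤ (1 - t) * Real.sinh a * Real.cosh A := by
    have h5 : 0 ≤ 1 - t := by linarith
    gcongr
  linarith

lemma sin_bound (t a : ℝ) (ht : 0 ≤ t) (ht1 : t ≤ 1) (ha : 0 < a) (haA : a < Real.pi) :
    t ≤ Real.sin (t * a) / Real.sin a := by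
  have hs : 0 < Real.sin a := Real.sin_pos_of_pos_of_lt_pi ha haA
  rw [le_div_iff₀ hs]
  have := strictConcaveOn_sin_Icc.concaveOn.2 (x := a) (y := 0) ⟨ha.le, haA.le⟩
    ⟨le_rfl, Real.pi_pos.le⟩ ht (by linarith : 0 ≤ 1 - t) (by ring)
  simpa using this

lemma sigma_bound (K N R t θ : ℝ) (hN : 0 < N) (ht : 0 ≤ t) (ht1 : t ≤ 1) (hθ : 0 ≤ θ)
    (hR : θ ≤ R) :
    ENNReal.ofReal (1 - (1 - t) * Real.cosh (R * Real.sqrt (-K / N))) ≤ sigmaCoeff K N t θ := by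
  have hc := Real.one_le_cosh (R * Real.sqrt (-K / N))
  have ht' : 1 - (1 - t) * Real.cosh (R * Real.sqrt (-K / N)) ≤ t := by nlinarith
  unfold sigmaCoeff
  split_ifs with h1 h2 h3
  · exact le_top
  · refine ENNReal.ofReal_le_ofReal (ht'.trans ?_)
    have hθ0 : θ ≠ 0 := by rintro rfl; simp at h2
    have hθp : 0 < θ := lt_of_le_of_ne hθ hθ0.symm
    have hK : 0 < K := by
      by_contra hK
      nlinarith [sq_nonneg θ]
    have hKN : 0 < K / N := div_pos hK hN
    rw [mul_assoc]
    apply sin_bound t _ ht ht1 (mul_pos hθp (Real.sqrt_pos.2 hKN))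
    refine lt_of_pow_lt_pow_left₀ 2 Real.pi_pos.le ?_
    rw [mul_pow, Real.sq_sqrt hKN.le, ← mul_div_assoc, div_lt_iff₀ hN]
    push Not at h1
    linarith
  · exact ENNReal.ofReal_le_ofReal ht'
  · refine ENNReal.ofReal_le_ofReal ?_
    have hθ0 : θ ≠ 0 := by rintro rfl; simp at h3
    have hθp : 0 < θ := lt_of_le_of_ne hθ hθ0.symm
    have hK : K < 0 := by
      by_contra hK
      push Not at hK h2
      exact h3 (le_antisymm h2 (by positivity))
    have hKN : 0 < -K / N := div_pos (by linarith) hN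
    rw [mul_assoc]
    exact sinh_bound t _ _ ht ht1 (mul_pos hθp (Real.sqrt_pos.2 hKN))
      (mul_le_mul_of_nonneg_right hR (Real.sqrt_nonneg _))

lemma sigma_pos (K N t θ : ℝ) (hN : 0 < N) (ht : 0 < t) (ht1 : t ≤ 1) (hθ : 0 ≤ θ) :
    0 < sigmaCoeff K N t θ := by
  unfold sigmaCoeff
  split_ifs with h1 h2 h3
  · simp
  · rw [ENNReal.ofReal_pos]
    have hθ0 : θ ≠ 0 := by rintro rfl; simp at h2
    have hθp : 0 < θ := lt_of_le_of_ne hθ hθ0.symm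
    have hK : 0 < K := by
      by_contra hK
      nlinarith [sq_nonneg θ]
    have hKN : 0 < K / N := div_pos hK hN
    rw [mul_assoc]
    refine ht.trans_le (sin_bound t _ ht.le ht1 (mul_pos hθp (Real.sqrt_pos.2 hKN)) ?_)
    refine lt_of_pow_lt_pow_left₀ 2 Real.pi_pos.le ?_
    rw [mul_pow, Real.sq_sqrt hKN.le, ← mul_div_assoc, div_lt_iff₀ hN]
    push Not at h1
    linarith
  · simpa using ht
  · rw [ENNReal.ofReal_pos]
    have hθ0 : θ ≠ 0 := by rintro rfl; simp at h3
    have hθp : 0 < θ := lt_of_le_of_ne hθ hθ0.symm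
    have hK : K < 0 := by
      by_contra hK
      push Not at hK h2
      exact h3 (le_antisymm h2 (by positivity))
    have hKN : 0 < Real.sqrt (-K / N) := Real.sqrt_pos.2 (div_pos (by linarith) hN)
    apply div_pos <;> rw [Real.sinh_pos_iff] <;> positivity

/-! ### A measurable selection -/

/-- Successive argmin sets. -/
def Ksel {Y Z : Type*} (g : ℕ → Z → ℝ) (K0 : Y → Set Z) : ℕ → Y → Set Z
  | 0, y => K0 y
  | n + 1, y => {z | z ∈ Ksel g K0 n y ∧ ∀ w ∈ Ksel g K0 n y, g n z ≤ g n w}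

lemma Ksel_compact {Y Z : Type*} [MetricSpace Z] (g : ℕ → Z → ℝ) (hg : ∀ n, Continuous (g n))
    (K0 : Y → Set Z) (y : Y) (h : IsCompact (K0 y)) (n : ℕ) : IsCompact (Ksel g K0 n y) := by
  induction n with
  | zero => exact h
  | succ n ih =>
    have : Ksel g K0 (n + 1) y = Ksel g K0 n y ∩ ⋂ w ∈ Ksel g K0 n y, {z | g n z ≤ g n w} := by
      ext z; simp [Ksel]
    rw [this]
    exact ih.inter_right (isClosed_biInter fun w _ => isClosed_le (hg n) continuous_const)

lemma Ksel_nonempty {Y Z : Type*} [MetricSpace Z] (g : ℕ → Z → ℝ) (hg : ∀ n, Continuous (g n))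
    (K0 : Y → Set Z) (y : Y) (h : IsCompact (K0 y)) (h0 : (K0 y).Nonempty) (n : ℕ) :
    (Ksel g K0 n y).Nonempty := by
  induction n with
  | zero => exact h0
  | succ n ih =>
    obtain ⟨z, hz, hz'⟩ := (Ksel_compact g hg K0 y h n).exists_isMinOn ih (hg n).continuousOn
    exact ⟨z, hz, fun w hw => hz' hw⟩

lemma Ksel_meas {Y Z : Type*} [MetricSpace Z] [MeasurableSpace Y]
    (g : ℕ → Z → ℝ) (hg : ∀ n, Continuous (g n))
    (K0 : Y → Set Z) (h : ∀ y, IsCompact (K0 y))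
    (h0 : ∀ F : Set Z, IsClosed F → MeasurableSet {y | (K0 y ∩ F).Nonempty}) (n : ℕ) :
    ∀ F : Set Z, IsClosed F → MeasurableSet {y | (Ksel g K0 n y ∩ F).Nonempty} := by
  induction n with
  | zero => exact h0
  | succ n ih =>
    intro F hF
    have hc : ∀ c : ℝ, IsClosed {z | g n z ≤ c} := fun c => isClosed_le (hg n) continuous_const
    have key : {y | (Ksel g K0 (n + 1) y ∩ F).Nonempty} =
        {y | (Ksel g K0 n y ∩ univ).Nonempty} ∩ ⋂ c : ℚ,
          ({y | (Ksel g K0 n y ∩ {z | g n z ≤ c}).Nonempty}ᶜ ∪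
            {y | (Ksel g K0 n y ∩ (F ∩ {z | g n z ≤ c})).Nonempty}) := by
      ext y
      simp only [mem_ofPred_eq, mem_inter_iff, mem_iInter, mem_union, mem_compl_iff]
      constructor
      · rintro ⟨z, ⟨hz, hz'⟩, hzF⟩
        refine ⟨⟨z, hz, mem_univ _⟩, fun c => ?_⟩
        by_cases hh : (Ksel g K0 n y ∩ {z | g n z ≤ c}).Nonempty
        · obtain ⟨w, hw, hw'⟩ := hh
          exact Or.inr ⟨z, hz, hzF, (hz' w hw).trans hw'⟩
        · exact Or.inl hh
      · rintro ⟨⟨z0, hz0, -⟩, hall⟩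
        have hcomp := Ksel_compact g hg K0 y (h y) n
        obtain ⟨w, hw, hw'⟩ := hcomp.exists_isMinOn ⟨z0, hz0⟩ (hg n).continuousOn
        have hne : (Ksel g K0 n y ∩ F).Nonempty := by
          obtain ⟨c, hc⟩ := exists_rat_gt (g n w)
          rcases hall c with h1 | ⟨u, hu, huF, -⟩
          · exact absurd ⟨w, hw, hc.le⟩ h1
          · exact ⟨u, hu, huF⟩
        obtain ⟨z, hz, hz'⟩ := (hcomp.inter_right hF).exists_isMinOn hne (hg n).continuousOn
        refine ⟨z, ⟨hz.1, fun v hv => ?_⟩, hz.2⟩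
        refine le_trans ?_ (hw' hv)
        by_contra hlt
        push Not at hlt
        obtain ⟨c, hc1, hc2⟩ := exists_rat_btwn hlt
        rcases hall c with h1 | ⟨u, hu, huF, huc⟩
        · exact h1 ⟨w, hw, hc1.le⟩
        · have := hz' (show u ∈ Ksel g K0 n y ∩ F from ⟨hu, huF⟩)
          have h3 : g n z ≤ g n u := this
          have h4 : g n u ≤ c := huc
          linarith
    rw [key]
    refine (ih _ isClosed_univ).inter (MeasurableSet.iInter fun c => ?_)
    exact (ih _ (hc c)).compl.union (ih _ (hF.inter (hc c)))

lemma closed_proj {Y Z : Type*} [MetricSpace Y] [MetricSpace Z] (C : Set (Y × Z)) (hC : IsClosed C) (B : Set Z)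
    (hB : IsCompact B) : IsClosed {y | ∃ z ∈ B, (y, z) ∈ C} := by
  have : CompactSpace B := isCompact_iff_compactSpace.1 hB
  have h2 : IsClosed {q : Y × B | (q.1, (q.2 : Z)) ∈ C} :=
    hC.preimage (by fun_prop)
  have := isClosedMap_fst_of_compactSpace _ h2
  convert this using 1
  ext y
  simp

lemma selection {Y Z : Type*} [MetricSpace Y] [MeasurableSpace Y] [BorelSpace Y]
    [MetricSpace Z] [TopologicalSpace.SeparableSpace Z] [MeasurableSpace Z] [BorelSpace Z]
    [Nonempty Z] (C : Set (Y × Z)) (hC : IsClosed C) (B : Set Z) (hB : IsCompact B) :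
    ∃ f : Y → Z, Measurable f ∧ ∀ y, (∃ z ∈ B, (y, z) ∈ C) → f y ∈ B ∧ (y, f y) ∈ C := by
  classical
  set g : ℕ → Z → ℝ := fun n z => dist z (TopologicalSpace.denseSeq Z n) with hgdef
  have hg : ∀ n, Continuous (g n) := fun n => by fun_prop
  set K0 : Y → Set Z := fun y => {z | z ∈ B ∧ (y, z) ∈ C} with hK0
  have hK0c : ∀ y, IsCompact (K0 y) := fun y =>
    hB.inter_right (t := {z | (y, z) ∈ C}) (hC.preimage (by fun_prop))
  have hmeas0 : ∀ F : Set Z, IsClosed F → MeasurableSet {y | (K0 y ∩ F).Nonempty} := by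
    intro F hF
    have := (closed_proj C hC (B ∩ F) (hB.inter_right hF)).measurableSet
    convert this using 1
    ext y
    constructor
    · rintro ⟨z, ⟨h1, h2⟩, h3⟩; exact ⟨z, ⟨h1, h3⟩, h2⟩
    · rintro ⟨z, ⟨h1, h3⟩, h2⟩; exact ⟨z, ⟨h1, h2⟩, h3⟩
  have hmeas := Ksel_meas g hg K0 hK0c hmeas0
  have hcomp : ∀ n y, IsCompact (Ksel g K0 n y) := fun n y => Ksel_compact g hg K0 y (hK0c y) n
  have hanti : ∀ n y, Ksel g K0 (n + 1) y ⊆ Ksel g K0 n y := fun n y z hz => hz.1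
  have huniq : ∀ y z w, (∀ n, z ∈ Ksel g K0 n y) → (∀ n, w ∈ Ksel g K0 n y) → z = w := by
    intro y z w hz hw
    have heq : ∀ n, g n z = g n w := fun n =>
      le_antisymm ((hz (n + 1)).2 w (hw n)) ((hw (n + 1)).2 z (hz n))
    have hd := TopologicalSpace.denseRange_denseSeq Z
    have : (fun v => dist z v) = fun v => dist w v :=
      hd.equalizer (by fun_prop) (by fun_prop) (funext heq)
    have := congrFun this w
    simpa using this
  have hex : ∀ F : Set Z, IsClosed F → ∀ y, (∀ n, (Ksel g K0 n y ∩ F).Nonempty) →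
      ∃ z ∈ F, ∀ n, z ∈ Ksel g K0 n y := by
    intro F hF y hy
    obtain ⟨z, hz⟩ := IsCompact.nonempty_iInter_of_sequence_nonempty_isCompact_isClosed
      (fun n => Ksel g K0 n y ∩ F) (fun n => inter_subset_inter_left _ (hanti n y)) hy
      ((hcomp 0 y).inter_right hF) (fun n => ((hcomp n y).isClosed.inter hF))
    rw [mem_iInter] at hz
    exact ⟨z, (hz 0).2, fun n => (hz n).1⟩
  have hsel : ∀ y, ∃ z, (K0 y).Nonempty → ∀ n, z ∈ Ksel g K0 n y := by
    intro y
    by_cases hy : (K0 y).Nonempty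
    · obtain ⟨z, -, hz⟩ := hex univ isClosed_univ y (fun n => by
        simpa using Ksel_nonempty g hg K0 y (hK0c y) hy n)
      exact ⟨z, fun _ => hz⟩
    · exact ⟨Classical.arbitrary Z, fun h => absurd h hy⟩
  choose f0 hf0 using hsel
  have hP : MeasurableSet {y | (K0 y).Nonempty} := by simpa using hmeas0 univ isClosed_univ
  obtain ⟨c⟩ : Nonempty Z := inferInstance
  refine ⟨fun y => if (K0 y).Nonempty then f0 y else c, ?_, ?_⟩
  · refine measurable_of_isClosed fun F hF => ?_
    have : (fun y => if (K0 y).Nonempty then f0 y else c) ⁻¹' F =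
        (⋂ n, {y | (Ksel g K0 n y ∩ F).Nonempty}) ∪ ({y | (K0 y).Nonempty}ᶜ ∩ {y | c ∈ F}) := by
      ext y
      simp only [mem_preimage, mem_union, mem_iInter, mem_ofPred_eq, mem_inter_iff, mem_compl_iff]
      by_cases hy : (K0 y).Nonempty
      · simp only [hy, if_true, not_true, false_and, or_false]
        constructor
        · intro h n
          exact ⟨f0 y, hf0 y hy n, h⟩
        · intro h
          obtain ⟨z, hzF, hz⟩ := hex F hF y h
          rwa [huniq y (f0 y) z (hf0 y hy) hz]
      · simp only [hy, if_false, not_false_eq_true, true_and]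
        constructor
        · exact Or.inr
        · rintro (h | h)
          · exact absurd ((h 0).mono inter_subset_left) hy
          · exact h
    rw [this]
    exact (MeasurableSet.iInter fun n => hmeas n F hF).union (hP.compl.inter (MeasurableSet.const _))
  · rintro y ⟨z, hz, hz'⟩
    have hy : (K0 y).Nonempty := ⟨z, hz, hz'⟩
    simp only [hy, if_true]
    exact hf0 y hy 0

/-! ### The space of geodesics -/
section geo
variable {X : Type*} [MetricSpace X]

lemma Geo.dist_eval (γ : Geo X) (s t : unitInterval) :
    dist (eval s γ) (eval t γ) = |(s : ℝ) - t| * dist (eval 0 γ) (eval 1 γ) := γ.2 s t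

lemma Geo.continuous_val : Continuous (fun γ : Geo X => (γ.1 : C(unitInterval, X))) :=
  continuous_subtype_val

lemma Geo.continuous_eval (t : unitInterval) : Continuous (eval (X := X) t) :=
  (by fun_prop : Continuous fun f : C(unitInterval, X) => f t).comp Geo.continuous_val

/-- Convex combination in the unit interval. -/
def cvI (a b u : unitInterval) : unitInterval :=
  ⟨(1 - (u : ℝ)) * a + u * b, by
    constructor
    · have := a.2.1; have := b.2.1; have := u.2.1; have := u.2.2
      have h : 0 ≤ 1 - (u : ℝ) := by linarith
      positivity
    · have := a.2.2; have := b.2.2; have := u.2.1; have := u.2.2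
      nlinarith⟩

lemma cvI_continuous (a b : unitInterval) : Continuous (cvI a b) := by
  unfold cvI
  fun_prop

lemma cvI_coe (a b u : unitInterval) : ((cvI a b u : unitInterval) : ℝ) = (1 - (u : ℝ)) * a + u * b :=
  rfl
lemma cvI_zero (a b : unitInterval) : cvI a b 0 = a := by ext; simp [cvI]
lemma cvI_one (a b : unitInterval) : cvI a b 1 = b := by ext; simp [cvI]

/-- Restriction of a geodesic to a subinterval, reparametrized. -/
def seg (a b : unitInterval) (γ : Geo X) : Geo X :=
  ⟨γ.1.comp ⟨cvI a b, cvI_continuous a b⟩, by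
    intro s t
    simp only [ContinuousMap.comp_apply, ContinuousMap.coe_mk, cvI_zero, cvI_one]
    rw [γ.2, γ.2 a b, cvI_coe, cvI_coe]
    rw [← mul_assoc, ← abs_mul]
    congr 1
    rw [← abs_neg]
    congr 1
    ring⟩

lemma eval_seg (a b u : unitInterval) (γ : Geo X) : eval u (seg a b γ) = eval (cvI a b u) γ := rfl
lemma eval_seg_zero (a b : unitInterval) (γ : Geo X) : eval 0 (seg a b γ) = eval a γ := by
  rw [eval_seg, cvI_zero]
lemma eval_seg_one (a b : unitInterval) (γ : Geo X) : eval 1 (seg a b γ) = eval b γ := by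
  rw [eval_seg, cvI_one]

lemma seg_continuous (a b : unitInterval) : Continuous (seg (X := X) a b) := by
  refine Continuous.subtype_mk ?_ _
  exact (ContinuousMap.continuous_precomp _).comp Geo.continuous_val

lemma seg_meas (a b : unitInterval) : Measurable (seg (X := X) a b) :=
  (seg_continuous a b).measurable

/-- The geodesic points to `x` with ratio `τ`, starting in the ball of radius `R`. -/
def Pt (x : X) (τ R : ℝ) (γ : Geo X) : Prop :=
  dist (eval 0 γ) x ≤ R ∧ dist (eval 0 γ) (eval 1 γ) = τ * dist (eval 0 γ) x ∧
    dist (eval 1 γ) x = (1 - τ) * dist (eval 0 γ) x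

lemma Pt_closed (x : X) (τ R : ℝ) : IsClosed {γ : Geo X | Pt x τ R γ} := by
  have h0 := Geo.continuous_eval (X := X) 0
  have h1 := Geo.continuous_eval (X := X) 1
  have e1 : IsClosed {γ : Geo X | dist (eval 0 γ) x ≤ R} := isClosed_le (by fun_prop) (by fun_prop)
  have e2 : IsClosed {γ : Geo X | dist (eval 0 γ) (eval 1 γ) = τ * dist (eval 0 γ) x} :=
    isClosed_eq (by fun_prop) (by fun_prop)
  have e3 : IsClosed {γ : Geo X | dist (eval 1 γ) x = (1 - τ) * dist (eval 0 γ) x} :=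
    isClosed_eq (by fun_prop) (by fun_prop)
  exact e1.inter (e2.inter e3)

lemma Pt.dist_mid {x : X} {τ R : ℝ} {γ : Geo X} (h : Pt x τ R γ)
    (s : unitInterval) : dist (eval s γ) x = (1 - s * τ) * dist (eval 0 γ) x := by
  obtain ⟨_, h1, h2⟩ := h
  have h3 := Geo.dist_eval γ 0 s
  have h4 := Geo.dist_eval γ s 1
  rw [h1] at h3 h4
  have hs0 := s.2.1
  have hs1 := s.2.2
  simp only [Set.Icc.coe_zero, Set.Icc.coe_one] at h3 h4
  rw [abs_of_nonpos (by linarith)] at h3 h4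
  have h5 := dist_triangle (eval s γ) (eval 1 γ) x
  have h6 := dist_triangle (eval 0 γ) (eval s γ) x
  apply le_antisymm <;> nlinarith

lemma Pt.seg {x : X} {τ R : ℝ} {γ : Geo X} (h : Pt x τ R γ) (hτ : 0 < τ) (hτ1 : τ < 1)
    (a b : unitInterval) (hab : a ≤ b) : Pt x ((b - a) * τ / (1 - a * τ)) R (seg a b γ) := by
  have ha := h.dist_mid a
  have hb := h.dist_mid b
  have hd := Geo.dist_eval γ a b
  rw [h.2.1] at hd
  have hab' : (a : ℝ) ≤ b := hab
  rw [abs_of_nonpos (by linarith)] at hd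
  have ha0 := a.2.1
  have ha1 := a.2.2
  have hpos : 0 < 1 - a * τ := by nlinarith
  refine ⟨?_, ?_, ?_⟩
  · rw [eval_seg_zero, ha]
    have : (1 - (a : ℝ) * τ) ≤ 1 := by nlinarith
    have h7 : 0 ≤ dist (eval 0 γ) x := dist_nonneg
    nlinarith [h.1]
  · rw [eval_seg_zero, eval_seg_one, hd, ha]
    field_simp
    ring
  · rw [eval_seg_zero, eval_seg_one, hb, ha, ← mul_assoc]
    have hq : (1 - ((b : ℝ) - a) * τ / (1 - a * τ)) * (1 - a * τ) = 1 - b * τ := by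
      rw [sub_mul 1, div_mul_cancel₀ _ hpos.ne']
      ring
    rw [hq]

lemma geo_compact [ProperSpace X] (x : X) (R : ℝ) :
    IsCompact {γ : Geo X | dist (eval 0 γ) x ≤ R ∧ dist (eval 0 γ) (eval 1 γ) ≤ R} := by
  have hcl : IsClosed {f : C(unitInterval, X) | IsUnitGeodesic f} := by
    have : {f : C(unitInterval, X) | IsUnitGeodesic f} = ⋂ (s : unitInterval) (t : unitInterval),
      {f : C(unitInterval, X) | dist (f s) (f t) = |(s : ℝ) - (t : ℝ)| * dist (f 0) (f 1)} := by
      ext f; simp only [IsUnitGeodesic, mem_iInter, mem_ofPred_eq]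
    rw [this]
    exact isClosed_iInter fun s => isClosed_iInter fun t => isClosed_eq (by fun_prop) (by fun_prop)
  have hemb : Topology.IsClosedEmbedding (fun γ : Geo X => (γ.1 : C(unitInterval, X))) :=
    hcl.isClosedEmbedding_subtypeVal
  set S : Set C(unitInterval, X) := {f | IsUnitGeodesic f ∧ dist (f 0) x ≤ R ∧
    dist (f 0) (f 1) ≤ R} with hS
  have hlip : ∀ f : unitInterval → X, (∀ s t : unitInterval, dist (f s) (f t) =
      |(s : ℝ) - (t : ℝ)| * dist (f 0) (f 1)) → dist (f 0) (f 1) ≤ R →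
      ∀ s t, dist (f s) (f t) ≤ R * dist s t := by
    intro f hf hR s t
    rw [hf s t, mul_comm R]
    exact mul_le_mul_of_nonneg_left hR (abs_nonneg _)
  have hSc : IsCompact S := by
    refine ArzelaAscoli.isCompact_of_equicontinuous S ?_ ?_
    · have himg : ContinuousMap.toFun '' S = {f : unitInterval → X | (∀ s t : unitInterval,
          dist (f s) (f t) = |(s : ℝ) - (t : ℝ)| * dist (f 0) (f 1)) ∧ dist (f 0) x ≤ R ∧
          dist (f 0) (f 1) ≤ R} := by
        ext f
        constructor
        · rintro ⟨g, hg, rfl⟩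
          exact hg
        · intro hf
          have hc : Continuous f :=
            (LipschitzWith.of_dist_le_mul (K := R.toNNReal) (f := f) (fun s t =>
              (hlip f hf.1 hf.2.2 s t).trans (mul_le_mul_of_nonneg_right (Real.le_coe_toNNReal R)
                dist_nonneg))).continuous
          exact ⟨⟨f, hc⟩, hf, rfl⟩
      rw [himg]
      refine IsCompact.of_isClosed_subset
        (isCompact_univ_pi (fun _ : unitInterval => isCompact_closedBall x (2 * R))) ?_ ?_
      · have e1 : IsClosed {f : unitInterval → X | dist (f 0) x ≤ R} :=
          isClosed_le (by fun_prop) (by fun_prop)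
        have e2 : IsClosed {f : unitInterval → X | dist (f 0) (f 1) ≤ R} :=
          isClosed_le (by fun_prop) (by fun_prop)
        refine IsClosed.inter ?_ (e1.inter e2)
        have : {f : unitInterval → X | ∀ s t : unitInterval,
          dist (f s) (f t) = |(s : ℝ) - (t : ℝ)| * dist (f 0) (f 1)} =
          ⋂ (s : unitInterval) (t : unitInterval),
          {f | dist (f s) (f t) = |(s : ℝ) - (t : ℝ)| * dist (f 0) (f 1)} := by
          ext f; simp only [mem_iInter, mem_ofPred_eq]
        change IsClosed {f : unitInterval → X | ∀ s t : unitInterval,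
          dist (f s) (f t) = |(s : ℝ) - (t : ℝ)| * dist (f 0) (f 1)}
        rw [this]
        exact isClosed_iInter fun s => isClosed_iInter fun t =>
          isClosed_eq (by fun_prop) (by fun_prop)
      · rintro f ⟨hf, hf1, hf2⟩ s -
        rw [mem_closedBall]
        have h1 := hlip f hf hf2 s 0
        have h2 : dist s 0 ≤ 1 := by
          rw [Subtype.dist_eq, Real.dist_eq]
          simpa [abs_of_nonneg s.2.1] using s.2.2
        have h3 : 0 ≤ R := dist_nonneg.trans hf1
        have h4 := dist_triangle (f s) (f 0) x
        nlinarith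
    · refine LipschitzWith.uniformEquicontinuous _ R.toNNReal ?_ |>.equicontinuous
      rintro ⟨f, hf⟩
      exact LipschitzWith.of_dist_le_mul (fun s t =>
              (hlip f hf.1 hf.2.2 s t).trans (mul_le_mul_of_nonneg_right (Real.le_coe_toNNReal R)
                dist_nonneg))
  have := hemb.isCompact_preimage hSc
  convert this using 1
  ext γ
  exact ⟨fun h => ⟨γ.2, h.1, h.2⟩, fun h => h.2⟩

instance geo_secondCountable [SecondCountableTopology X] : SecondCountableTopology (Geo X) := by
  unfold Geo
  infer_instance

end geo

section plans
variable {X : Type*} [MetricSpace X] [MeasurableSpace X] [BorelSpace X]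

lemma eval_meas (t : unitInterval) : Measurable (eval (X := X) t) :=
  (Geo.continuous_eval t).measurable

lemma young (τ a b c : ℝ) (hτ : 0 < τ) (hτ1 : τ < 1) (ha : 0 ≤ a) (h : a ≤ b + c) :
    a ^ 2 ≤ b ^ 2 / (1 - τ) + c ^ 2 / τ := by
  have h1 : 0 < 1 - τ := by linarith
  have : b ^ 2 / (1 - τ) + c ^ 2 / τ - (b + c) ^ 2 = (τ * b - (1 - τ) * c) ^ 2 / (τ * (1 - τ)) := by
    field_simp
    ring
  have h2 : 0 ≤ (τ * b - (1 - τ) * c) ^ 2 / (τ * (1 - τ)) := by positivity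
  nlinarith

lemma young_eq (τ a b c : ℝ) (hτ : 0 < τ) (hτ1 : τ < 1) (ha : 0 ≤ a) (hb : 0 ≤ b) (hc : 0 ≤ c)
    (h : a ≤ b + c)
    (he : a ^ 2 = b ^ 2 / (1 - τ) + c ^ 2 / τ) : c = τ * a ∧ b = (1 - τ) * a := by
  have h1 : 0 < 1 - τ := by linarith
  have h3 : b ^ 2 / (1 - τ) + c ^ 2 / τ - (b + c) ^ 2 = (τ * b - (1 - τ) * c) ^ 2 / (τ * (1 - τ)) := by
    field_simp
    ring
  have h2 : 0 ≤ (τ * b - (1 - τ) * c) ^ 2 / (τ * (1 - τ)) := by positivity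
  have h4 : a ^ 2 = (b + c) ^ 2 := by nlinarith
  have h5 : a = b + c := by
    rwa [sq_eq_sq₀ ha (by positivity)] at h4
  have h6 : (τ * b - (1 - τ) * c) ^ 2 / (τ * (1 - τ)) = 0 := by rw [← h3, ← he, h4]; ring
  have h7 : τ * b - (1 - τ) * c = 0 := by
    rcases div_eq_zero_iff.1 h6 with h8 | h8
    · exact pow_eq_zero_iff (two_ne_zero) |>.1 h8
    · nlinarith
  constructor <;> rw [h5] <;> linarith

/-- squared-distance-to-`x` moment -/
def mom (x : X) (μ : Measure X) : ℝ≥0∞ := ∫⁻ y, ENNReal.ofReal (dist y x ^ 2) ∂μ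

lemma mom_map [SecondCountableTopology X] (x : X) (π : Measure (Geo X)) (t : unitInterval) :
    ∫⁻ γ, ENNReal.ofReal (dist (eval t γ) x ^ 2) ∂π = mom x (π.map (eval t)) := by
  rw [mom, lintegral_map (f := fun y => ENNReal.ofReal (dist y x ^ 2)) (by fun_prop) (eval_meas t)]

lemma meas_dist01 : Measurable fun γ : Geo X => ENNReal.ofReal (dist (eval 0 γ) (eval 1 γ) ^ 2) := by
  have h0 := Geo.continuous_eval (X := X) 0
  have h1 := Geo.continuous_eval (X := X) 1
  exact (ENNReal.continuous_ofReal.comp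
    (by fun_prop : Continuous fun γ : Geo X => dist (eval 0 γ) (eval 1 γ) ^ 2)).measurable

lemma int_young [SecondCountableTopology X] (x : X) (τ : ℝ) (hτ : 0 < τ) (hτ1 : τ < 1) (π : Measure (Geo X)) :
    ∫⁻ γ, ENNReal.ofReal (dist (eval 1 γ) x ^ 2 / (1 - τ) + dist (eval 0 γ) (eval 1 γ) ^ 2 / τ) ∂π
      = ENNReal.ofReal (1 - τ)⁻¹ * mom x (π.map (eval 1)) + ENNReal.ofReal τ⁻¹ * transportCost π := by
  have h1 := Geo.continuous_eval (X := X) 1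
  have h2 : 0 < 1 - τ := by linarith
  rw [← mom_map, transportCost, ← lintegral_const_mul' _ _ ENNReal.ofReal_ne_top,
    ← lintegral_const_mul' _ _ ENNReal.ofReal_ne_top, ← lintegral_add_right _ (meas_dist01.const_mul _)]
  congr 1
  ext γ
  rw [ENNReal.ofReal_add (by positivity) (by positivity), div_eq_inv_mul, div_eq_inv_mul,
    ENNReal.ofReal_mul (by positivity), ENNReal.ofReal_mul (by positivity)]

lemma Pt_opt [SecondCountableTopology X] {x : X} {τ R : ℝ} (hτ : 0 < τ) (hτ1 : τ < 1)
    {π : Measure (Geo X)} [IsProbabilityMeasure π] (h : ∀ᵐ γ ∂π, Pt x τ R γ) :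
    IsOptGeo (π.map (eval 0)) (π.map (eval 1)) π := by
  refine ⟨inferInstance, rfl, rfl, ?_⟩
  intro π' hπ' h0 h1
  have h2 : 0 < 1 - τ := by linarith
  have hfin : mom x (π.map (eval 1)) ≠ ⊤ := by
    rw [← mom_map]
    have : ∫⁻ γ, ENNReal.ofReal (dist (eval 1 γ) x ^ 2) ∂π ≤ ∫⁻ γ, ENNReal.ofReal (R ^ 2) ∂π := by
      refine lintegral_mono_ae ?_
      filter_upwards [h] with γ hγ
      refine ENNReal.ofReal_le_ofReal (pow_le_pow_left₀ dist_nonneg ?_ 2)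
      rw [hγ.2.2]
      have : 0 ≤ dist (eval 0 γ) x := dist_nonneg
      nlinarith [hγ.1]
    refine ne_top_of_le_ne_top ?_ this
    simp
  have e1 : mom x (π.map (eval 0)) = ENNReal.ofReal (1 - τ)⁻¹ * mom x (π.map (eval 1)) +
      ENNReal.ofReal τ⁻¹ * transportCost π := by
    rw [← int_young x τ hτ hτ1, ← mom_map]
    refine lintegral_congr_ae ?_
    filter_upwards [h] with γ hγ
    rw [hγ.2.1, hγ.2.2]
    congr 1
    field_simp
    ring
  have e2 : mom x (π.map (eval 0)) ≤ ENNReal.ofReal (1 - τ)⁻¹ * mom x (π.map (eval 1)) +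
      ENNReal.ofReal τ⁻¹ * transportCost π' := by
    rw [← h1, ← int_young x τ hτ hτ1, ← h0, ← mom_map]
    refine lintegral_mono fun γ => ENNReal.ofReal_le_ofReal ?_
    refine young τ _ _ _ hτ hτ1 dist_nonneg ?_
    linarith [dist_triangle (eval 0 γ) (eval 1 γ) x]
  rw [e1] at e2
  have e3 := (ENNReal.add_le_add_iff_left (ENNReal.mul_ne_top ENNReal.ofReal_ne_top hfin)).1 e2
  refine (ENNReal.mul_le_mul_iff_right ?_ ENNReal.ofReal_ne_top).1 e3
  simpa using hτ

/-- Any optimal plan with the same marginals as a pointing plan is pointing. -/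
lemma Pt_of_opt [SecondCountableTopology X] {x : X} {τ R : ℝ} (hτ : 0 < τ) (hτ1 : τ < 1)
    {π π' : Measure (Geo X)} [IsProbabilityMeasure π] (h : ∀ᵐ γ ∂π, Pt x τ R γ)
    (hπ' : IsOptGeo (π.map (eval 0)) (π.map (eval 1)) π') : ∀ᵐ γ ∂π', Pt x τ R γ := by
  obtain ⟨hp', h0, h1, hopt⟩ := hπ'
  have hcost := hopt π inferInstance rfl rfl
  have h2 : 0 < 1 - τ := by linarith
  have hfin : mom x (π.map (eval 0)) ≠ ⊤ := by
    rw [← mom_map]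
    have : ∫⁻ γ, ENNReal.ofReal (dist (eval 0 γ) x ^ 2) ∂π ≤ ∫⁻ γ, ENNReal.ofReal (R ^ 2) ∂π := by
      refine lintegral_mono_ae ?_
      filter_upwards [h] with γ hγ
      exact ENNReal.ofReal_le_ofReal (pow_le_pow_left₀ dist_nonneg hγ.1 2)
    refine ne_top_of_le_ne_top ?_ this
    simp
  have e1 : mom x (π.map (eval 0)) = ENNReal.ofReal (1 - τ)⁻¹ * mom x (π.map (eval 1)) +
      ENNReal.ofReal τ⁻¹ * transportCost π := by
    rw [← int_young x τ hτ hτ1, ← mom_map]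
    refine lintegral_congr_ae ?_
    filter_upwards [h] with γ hγ
    rw [hγ.2.1, hγ.2.2]
    congr 1
    field_simp
    ring
  have hc0 := Geo.continuous_eval (X := X) 0
  have hc1 := Geo.continuous_eval (X := X) 1
  have e2 := ae_eq_of_ae_le_of_lintegral_le (μ := π')
    (f := fun γ => ENNReal.ofReal (dist (eval 0 γ) x ^ 2))
    (g := fun γ => ENNReal.ofReal (dist (eval 1 γ) x ^ 2 / (1 - τ) +
      dist (eval 0 γ) (eval 1 γ) ^ 2 / τ))
    (Filter.Eventually.of_forall fun γ => ENNReal.ofReal_le_ofReal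
      (young τ _ _ _ hτ hτ1 dist_nonneg (by linarith [dist_triangle (eval 0 γ) (eval 1 γ) x])))
    (by rw [mom_map, h0]; exact hfin)
    (by
      have : Continuous fun γ : Geo X => dist (eval 1 γ) x ^ 2 / (1 - τ) +
        dist (eval 0 γ) (eval 1 γ) ^ 2 / τ := by fun_prop
      exact (ENNReal.continuous_ofReal.comp this).measurable.aemeasurable)
    (by
      rw [int_young x τ hτ hτ1, mom_map, h0, h1, e1]
      gcongr)
  have hR : ∀ᵐ γ ∂π', dist (eval 0 γ) x ≤ R := by
    have hm : MeasurableSet {y : X | dist y x ≤ R} :=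
      (isClosed_le (by fun_prop) (by fun_prop)).measurableSet
    have : ∀ᵐ y ∂(π.map (eval 0)), dist y x ≤ R := by
      rw [ae_map_iff (eval_meas 0).aemeasurable hm]
      filter_upwards [h] with γ hγ using hγ.1
    rw [← h0, ae_map_iff (eval_meas 0).aemeasurable hm] at this
    exact this
  filter_upwards [e2, hR] with γ hγ hγR
  have := (ENNReal.ofReal_eq_ofReal_iff (by positivity) (by positivity)).1 hγ
  obtain ⟨h5, h6⟩ := young_eq τ _ _ _ hτ hτ1 dist_nonneg dist_nonneg dist_nonneg
    (by linarith [dist_triangle (eval 0 γ) (eval 1 γ) x]) this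
  exact ⟨hγR, h5, h6⟩

end plans

section good
variable {X : Type*} [MetricSpace X] [MeasurableSpace X] [BorelSpace X]

/-- Standing assumptions. -/
structure Amb (m : Measure X) (K N : ℝ) : Prop where
  bdd : ∀ s : Set X, Bornology.IsBounded s → m s ≠ ⊤
  hN : 1 ≤ N
  cd : IsCDStar K N m
  gt : GoodTransport m

/-- Good plans. -/
structure Good (m : Measure X) (x : X) (τ R : ℝ) (π : Measure (Geo X)) : Prop where
  prob : IsProbabilityMeasure π
  ac0 : π.map (eval 0) ≪ m
  ac1 : π.map (eval 1) ≪ m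
  pt : ∀ᵐ γ ∂π, Pt x τ R γ

lemma prob_map (π : Measure (Geo X)) [IsProbabilityMeasure π] (t : unitInterval) :
    IsProbabilityMeasure (π.map (eval t)) :=
  Measure.isProbabilityMeasure_map (eval_meas t).aemeasurable

lemma Good.of_ac {m : Measure X} {x : X} {τ R : ℝ} {π π' : Measure (Geo X)}
    (h : Good m x τ R π) (hp : IsProbabilityMeasure π') (hac : π' ≪ π) : Good m x τ R π' :=
  ⟨hp, (hac.map (eval_meas 0)).trans h.ac0, (hac.map (eval_meas 1)).trans h.ac1, hac.ae_le h.pt⟩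

lemma mix_prob {Z : Type*} [MeasurableSpace Z] (π₁ π₂ : Measure Z) [IsProbabilityMeasure π₁]
    [IsProbabilityMeasure π₂] : IsProbabilityMeasure ((2⁻¹ : ℝ≥0∞) • (π₁ + π₂)) := by
  constructor
  simp only [Measure.smul_apply, Measure.add_apply, measure_univ, smul_eq_mul]
  rw [one_add_one_eq_two]
  exact ENNReal.inv_mul_cancel (by simp) (by simp)

lemma mix_map {Z Y : Type*} [MeasurableSpace Z] [MeasurableSpace Y] (π₁ π₂ : Measure Z)
    (f : Z → Y) (hf : Measurable f) :
    ((2⁻¹ : ℝ≥0∞) • (π₁ + π₂)).map f = (2⁻¹ : ℝ≥0∞) • (π₁.map f + π₂.map f) := by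
  rw [Measure.map_smul, Measure.map_add _ _ hf]

lemma Good.mix {m : Measure X} {x : X} {τ R : ℝ} {π₁ π₂ : Measure (Geo X)}
    (h₁ : Good m x τ R π₁) (h₂ : Good m x τ R π₂) :
    Good m x τ R ((2⁻¹ : ℝ≥0∞) • (π₁ + π₂)) := by
  have := h₁.prob
  have := h₂.prob
  refine ⟨mix_prob _ _, ?_, ?_, ?_⟩
  · rw [mix_map _ _ _ (eval_meas 0)]
    exact Measure.smul_absolutelyContinuous.trans (Measure.AbsolutelyContinuous.add_left h₁.ac0 h₂.ac0)
  · rw [mix_map _ _ _ (eval_meas 1)]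
    exact Measure.smul_absolutelyContinuous.trans (Measure.AbsolutelyContinuous.add_left h₁.ac1 h₂.ac1)
  · refine Measure.ae_smul_measure ?_ _
    rw [ae_add_measure_iff]
    exact ⟨h₁.pt, h₂.pt⟩

lemma sigma_meas (K N t : ℝ) : Measurable fun θ => sigmaCoeff K N t θ := by
  unfold sigmaCoeff
  refine Measurable.ite (measurableSet_le (by fun_prop) (by fun_prop)) (by fun_prop) ?_
  refine Measurable.ite (measurableSet_lt (by fun_prop) (by fun_prop)) ?_ ?_
  · exact (Measurable.div (Real.measurable_sin.comp (by fun_prop))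
      (Real.measurable_sin.comp (by fun_prop))).ennreal_ofReal
  refine Measurable.ite (measurableSet_eq_fun (by fun_prop) (by fun_prop)) (by fun_prop) ?_
  exact (Measurable.div (Real.measurable_sinh.comp (by fun_prop))
      (Real.measurable_sinh.comp (by fun_prop))).ennreal_ofReal

lemma cd_pos (m : Measure X) [SigmaFinite m] (K N : ℝ) (hN : 0 < N)
    (π : Measure (Geo X)) [IsProbabilityMeasure π] (hac : π.map (eval 0) ≪ m) (t : unitInterval)
    (ht : (t : ℝ) < 1)
    (h : ∫⁻ γ, (sigmaCoeff K (N + 1) (1 - (t : ℝ)) (dist (eval 0 γ) (eval 1 γ)) *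
                 ((π.map (eval 0)).rnDeriv m (eval 0 γ)) ^ (-(1 / (N + 1))) +
               sigmaCoeff K (N + 1) (t : ℝ) (dist (eval 0 γ) (eval 1 γ)) *
                 ((π.map (eval 1)).rnDeriv m (eval 1 γ)) ^ (-(1 / (N + 1)))) ∂π
          ≤ ∫⁻ x, ((π.map (eval t)).rnDeriv m x) ^ (1 - 1 / (N + 1)) ∂m) :
    ¬ (π.map (eval t)) ⟂ₘ m := by
  have := prob_map π t
  have := prob_map π 0
  have hp : 0 < 1 - 1 / (N + 1) := by
    rw [sub_pos, div_lt_one (by linarith)]; linarith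
  apply not_ms_of_Ufun m (1 - 1 / (N + 1)) hp
  have hpos : 0 < 1 / (N + 1) := by positivity
  unfold Ufun
  intro h0
  rw [h0, nonpos_iff_eq_zero] at h
  have h0 := Geo.continuous_eval (X := X) 0
  have h1 := Geo.continuous_eval (X := X) 1
  have hdm : Measurable fun γ : Geo X => dist (eval 0 γ) (eval 1 γ) :=
    (by fun_prop : Continuous fun γ : Geo X => dist (eval 0 γ) (eval 1 γ)).measurable
  have hm : Measurable fun γ : Geo X =>
      sigmaCoeff K (N + 1) (1 - (t : ℝ)) (dist (eval 0 γ) (eval 1 γ)) *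
                 ((π.map (eval 0)).rnDeriv m (eval 0 γ)) ^ (-(1 / (N + 1))) :=
    ((sigma_meas K (N + 1) (1 - t)).comp hdm).mul
      (((Measure.measurable_rnDeriv _ _).comp (eval_meas 0)).pow_const _)
  have h3 : ∫⁻ γ, sigmaCoeff K (N + 1) (1 - (t : ℝ)) (dist (eval 0 γ) (eval 1 γ)) *
                 ((π.map (eval 0)).rnDeriv m (eval 0 γ)) ^ (-(1 / (N + 1))) ∂π = 0 := by
    refine le_antisymm (le_trans (lintegral_mono fun γ => ?_) h.le) bot_le
    exact le_self_add
  rw [lintegral_eq_zero_iff hm] at h3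
  have h4 : ∀ᵐ γ ∂π, (π.map (eval 0)).rnDeriv m (eval 0 γ) < ⊤ :=
    ae_of_ae_map (eval_meas 0).aemeasurable (hac.ae_le (Measure.rnDeriv_lt_top (π.map (eval 0)) m))
  obtain ⟨γ, h5, h6⟩ := (h3.and h4).exists
  have h7 := sigma_pos K (N + 1) (1 - t) (dist (eval 0 γ) (eval 1 γ)) (by linarith) (by linarith)
    (by linarith [t.2.1]) dist_nonneg
  simp only [Pi.zero_apply, mul_eq_zero, h7.ne', false_or] at h5
  rw [ENNReal.rpow_neg, ENNReal.inv_eq_zero] at h5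
  exact (ENNReal.rpow_lt_top_of_nonneg hpos.le h6.ne).ne h5

lemma Good.cd [SecondCountableTopology X] {m : Measure X} {K N : ℝ} (A : Amb m K N) {x : X} {τ R : ℝ} (hτ : 0 < τ)
    (hτ1 : τ < 1) {π : Measure (Geo X)} (h : Good m x τ R π) (t : unitInterval) :
    ∫⁻ γ, (sigmaCoeff K (N + 1) (1 - (t : ℝ)) (dist (eval 0 γ) (eval 1 γ)) *
                 ((π.map (eval 0)).rnDeriv m (eval 0 γ)) ^ (-(1 / (N + 1))) +
               sigmaCoeff K (N + 1) (t : ℝ) (dist (eval 0 γ) (eval 1 γ)) *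
                 ((π.map (eval 1)).rnDeriv m (eval 1 γ)) ^ (-(1 / (N + 1)))) ∂π
          ≤ ∫⁻ x, ((π.map (eval t)).rnDeriv m x) ^ (1 - 1 / (N + 1)) ∂m := by
  have := h.prob
  have hb0 : ∀ᵐ γ ∂π, dist (eval 0 γ) x ≤ R := by
    filter_upwards [h.pt] with γ hγ using hγ.1
  have hb1 : ∀ᵐ γ ∂π, dist (eval 1 γ) x ≤ R := by
    filter_upwards [h.pt] with γ hγ
    rw [hγ.2.2]
    have : 0 ≤ dist (eval 0 γ) x := dist_nonneg
    nlinarith [hγ.1]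
  have hnull : ∀ u : unitInterval, (∀ᵐ γ ∂π, dist (eval u γ) x ≤ R) →
      (π.map (eval u)) (closedBall x R)ᶜ = 0 := by
    intro u hu
    rw [Measure.map_apply (eval_meas u) measurableSet_closedBall.compl]
    exact hu
  have hmom : ∀ u : unitInterval, (∀ᵐ γ ∂π, dist (eval u γ) x ≤ R) →
      HasFiniteSecondMoment (π.map (eval u)) := by
    intro u hu
    refine ⟨x, ?_⟩
    change mom x (π.map (eval u)) ≠ ⊤
    rw [← mom_map]
    have : ∫⁻ γ, ENNReal.ofReal (dist (eval u γ) x ^ 2) ∂π ≤ ∫⁻ γ, ENNReal.ofReal (R ^ 2) ∂π := by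
      refine lintegral_mono_ae ?_
      filter_upwards [hu] with γ hγ
      exact ENNReal.ofReal_le_ofReal (pow_le_pow_left₀ dist_nonneg hγ 2)
    refine ne_top_of_le_ne_top ?_ this
    simp
  obtain ⟨π', hopt', hineq⟩ := A.cd (π.map (eval 0)) (π.map (eval 1)) (prob_map π 0) (prob_map π 1)
    ⟨closedBall x R, isBounded_closedBall, hnull 0 hb0, hnull 1 hb1⟩
  have hopt := Pt_opt hτ hτ1 h.pt
  obtain ⟨hex, -⟩ := A.gt (π.map (eval 0)) (π.map (eval 1)) (prob_map π 0) (prob_map π 1)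
    (hmom 0 hb0) (hmom 1 hb1) h.ac0 h.ac1
  have heq : π' = π := hex.unique hopt' hopt
  rw [heq] at hineq
  exact hineq t (N + 1) (by linarith)

lemma Good.ac [SecondCountableTopology X] {m : Measure X} [SigmaFinite m] {K N : ℝ} (A : Amb m K N) {x : X} {τ R : ℝ} (hτ : 0 < τ)
    (hτ1 : τ < 1) {π : Measure (Geo X)} (h : Good m x τ R π) (t : unitInterval) :
    π.map (eval t) ≪ m := by
  have := h.prob
  rcases eq_or_lt_of_le t.2.2 with ht | ht
  · have : t = 1 := Subtype.ext ht
    rw [this]; exact h.ac1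
  refine Measure.AbsolutelyContinuous.mk fun Z hZ hmZ => ?_
  by_contra hne
  rw [Measure.map_apply (eval_meas t) hZ] at hne
  set S := eval t ⁻¹' Z with hS
  have hSm : MeasurableSet S := eval_meas t hZ
  have : IsProbabilityMeasure ((π S)⁻¹ • π.restrict S) := by
    have : NeZero (π.restrict S) := ⟨by rwa [Ne, Measure.restrict_eq_zero]⟩
    have h2 : (π S) = (π.restrict S) univ := by simp
    rw [h2]
    infer_instance
  have hac : (π S)⁻¹ • π.restrict S ≪ π :=
    Measure.smul_absolutelyContinuous.trans Measure.restrict_le_self.absolutelyContinuous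
  have hg := h.of_ac this hac
  have := cd_pos m K N (by linarith [A.hN]) _ hg.ac0 t ht (hg.cd A hτ hτ1 t)
  apply this
  refine Measure.MutuallySingular.symm ⟨Z, hZ, hmZ, ?_⟩
  rw [Measure.map_apply (eval_meas t) hZ.compl, Measure.smul_apply,
    Measure.restrict_apply (eval_meas t hZ.compl)]
  have : eval t ⁻¹' Zᶜ ∩ S = ∅ := by
    rw [hS, preimage_compl]; simp
  rw [this]; simp

/-- exponent -/
def pN (N : ℝ) : ℝ := 1 - 1 / (N + 1)
/-- distortion constant -/
def Mc (K N R : ℝ) : ℝ := Real.cosh (R * Real.sqrt (-K / (N + 1)))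

lemma pN_pos {N : ℝ} (hN : 1 ≤ N) : 0 < pN N := by
  unfold pN; rw [sub_pos, div_lt_one (by linarith)]; linarith
lemma pN_lt {N : ℝ} (hN : 1 ≤ N) : pN N < 1 := by
  unfold pN
  have : 0 < 1 / (N + 1) := by positivity
  linarith
lemma Mc_ge (K N R : ℝ) : 1 ≤ Mc K N R := Real.one_le_cosh _

lemma Good.U0 [SecondCountableTopology X] {m : Measure X} [SigmaFinite m] {K N : ℝ} (A : Amb m K N) {x : X} {τ R : ℝ} (hτ : 0 < τ)
    (hτ1 : τ < 1) {π : Measure (Geo X)} (h : Good m x τ R π) (t : unitInterval) :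
    ENNReal.ofReal (1 - t * Mc K N R) * Ufun m (pN N) (π.map (eval 0)) +
    ENNReal.ofReal (1 - (1 - t) * Mc K N R) * Ufun m (pN N) (π.map (eval 1)) ≤
    Ufun m (pN N) (π.map (eval t)) := by
  have := h.prob
  have := prob_map π 0
  have := prob_map π 1
  refine le_trans ?_ (h.cd A hτ hτ1 t)
  have hq1 : 1 / (N + 1) < 1 := by
    rw [div_lt_one (by linarith [A.hN])]; linarith [A.hN]
  have hr0 := (Measure.measurable_rnDeriv (π.map (eval 0)) m)
  have hr1 := (Measure.measurable_rnDeriv (π.map (eval 1)) m)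
  unfold pN
  rw [← Ufun_eq m _ hq1 _ h.ac0, ← Ufun_eq m _ hq1 _ h.ac1,
    lintegral_map (hr0.pow_const _) (eval_meas 0), lintegral_map (hr1.pow_const _) (eval_meas 1),
    ← lintegral_const_mul' _ _ ENNReal.ofReal_ne_top, ← lintegral_const_mul' _ _ ENNReal.ofReal_ne_top]
  have hm : Measurable fun γ : Geo X => ENNReal.ofReal (1 - t * Mc K N R) *
      (π.map (eval 0)).rnDeriv m (eval 0 γ) ^ (-(1/(N+1))) :=
    ((hr0.comp (eval_meas 0)).pow_const _).const_mul _
  rw [← lintegral_add_left hm]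
  refine lintegral_mono_ae ?_
  filter_upwards [h.pt] with γ hγ
  have hd : dist (eval 0 γ) (eval 1 γ) ≤ R := by
    rw [hγ.2.1]
    have : 0 ≤ dist (eval 0 γ) x := dist_nonneg
    nlinarith [hγ.1]
  have s1 := sigma_bound K (N + 1) R (1 - t) _ (by linarith [A.hN]) (by linarith [t.2.2])
    (by linarith [t.2.1]) dist_nonneg hd
  have s2 := sigma_bound K (N + 1) R t _ (by linarith [A.hN]) t.2.1 t.2.2 dist_nonneg hd
  have e1 : (1 : ℝ) - (1 - t) = t := by ring
  rw [e1] at s1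
  exact add_le_add (mul_le_mul_left s1 _) (mul_le_mul_left s2 _)

lemma Good.U [SecondCountableTopology X] {m : Measure X} [SigmaFinite m] {K N : ℝ} (A : Amb m K N) {x : X} {τ R : ℝ} (hτ : 0 < τ)
    (hτ1 : τ < 1) {π : Measure (Geo X)} (h : Good m x τ R π) (a s b : unitInterval) (hab : a < b)
    (has : a ≤ s) (hsb : s ≤ b) :
    ENNReal.ofReal (1 - ((s : ℝ) - a) / (b - a) * Mc K N R) * Ufun m (pN N) (π.map (eval a)) +
    ENNReal.ofReal (1 - ((b : ℝ) - s) / (b - a) * Mc K N R) * Ufun m (pN N) (π.map (eval b)) ≤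
    Ufun m (pN N) (π.map (eval s)) := by
  have := h.prob
  have hab' : (a : ℝ) < b := hab
  have has' : (a : ℝ) ≤ s := has
  have hsb' : (s : ℝ) ≤ b := hsb
  have ha0 := a.2.1
  have ha1 := a.2.2
  have hb1 := b.2.2
  have hba : 0 < (b : ℝ) - a := by linarith
  have hmap : ∀ u, (π.map (seg a b)).map (eval u) = π.map (eval (cvI a b u)) := by
    intro u
    rw [Measure.map_map (eval_meas u) (seg_meas a b)]
    rfl
  have hpos : 0 < 1 - a * τ := by nlinarith
  have hg : Good m x (((b : ℝ) - a) * τ / (1 - a * τ)) R (π.map (seg a b)) := by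
    refine ⟨Measure.isProbabilityMeasure_map (seg_meas a b).aemeasurable, ?_, ?_, ?_⟩
    · rw [hmap, cvI_zero]; exact h.ac A hτ hτ1 a
    · rw [hmap, cvI_one]; exact h.ac A hτ hτ1 b
    · rw [ae_map_iff (seg_meas a b).aemeasurable (Pt_closed _ _ _).measurableSet]
      filter_upwards [h.pt] with γ hγ using hγ.seg hτ hτ1 a b hab.le
  have h1 : 0 < ((b : ℝ) - a) * τ / (1 - a * τ) := by positivity
  have h2 : ((b : ℝ) - a) * τ / (1 - a * τ) < 1 := by
    rw [div_lt_one hpos]; nlinarith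
  have key := hg.U0 A h1 h2 ⟨((s : ℝ) - a) / (b - a), div_nonneg (by linarith) hba.le,
    (div_le_one hba).2 (by linarith)⟩
  have hs : cvI a b ⟨((s : ℝ) - a) / (b - a), div_nonneg (by linarith) hba.le,
    (div_le_one hba).2 (by linarith)⟩ = s := by
    ext
    rw [cvI_coe]
    field_simp
    ring
  rw [hmap, hmap, hmap, cvI_zero, cvI_one, hs] at key
  have : (1 : ℝ) - ((s : ℝ) - a) / (b - a) = ((b : ℝ) - s) / (b - a) := by
    field_simp
    ring
  simp only [this] at key
  exact key

end good

section fin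
variable {X : Type*} [MetricSpace X] [MeasurableSpace X] [BorelSpace X] [SecondCountableTopology X]

lemma Good.dist_le {m : Measure X} {x : X} {τ R : ℝ} (hτ : 0 < τ)
    (hτ1 : τ < 1) {π : Measure (Geo X)} (h : Good m x τ R π) (s : unitInterval) :
    ∀ᵐ γ ∂π, dist (eval s γ) x ≤ R := by
  filter_upwards [h.pt] with γ hγ
  rw [hγ.dist_mid s]
  have h0 : 0 ≤ dist (eval 0 γ) x := dist_nonneg
  have h1 := s.2.1
  have h2 := s.2.2
  have h3 : 0 ≤ s * τ := by positivity
  nlinarith [hγ.1]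

lemma Good.U_fin {m : Measure X} [SigmaFinite m] {K N : ℝ} (A : Amb m K N) {x : X} {τ R : ℝ}
    (hτ : 0 < τ) (hτ1 : τ < 1) {π : Measure (Geo X)} (h : Good m x τ R π) (s : unitInterval) :
    Ufun m (pN N) (π.map (eval s)) ≠ ⊤ ∧ Ufun m (pN N) (π.map (eval s)) ≠ 0 := by
  have := h.prob
  have := prob_map π s
  have hac := h.ac A hτ hτ1 s
  constructor
  · refine ne_top_of_le_ne_top ?_ (Ufun_le m (pN N) (pN_pos A.hN) (pN_lt A.hN) _ hac (closedBall x R)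
      measurableSet_closedBall ?_)
    · exact ENNReal.rpow_ne_top_of_nonneg (by linarith [pN_lt A.hN]) (A.bdd _ isBounded_closedBall)
    · rw [Measure.map_apply (eval_meas s) measurableSet_closedBall.compl]
      exact h.dist_le hτ hτ1 s
  · apply Ufun_ne_zero m _ (pN_pos A.hN)
    intro hms
    have := Measure.eq_zero_of_absolutelyContinuous_of_mutuallySingular hac hms
    exact IsProbabilityMeasure.ne_zero _ this

lemma half_pow (p : ℝ) : (2⁻¹ : ℝ≥0∞) ^ p * 2 = ENNReal.ofReal (2 ^ (1 - p)) := by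
  rw [← ENNReal.ofReal_rpow_of_pos (by norm_num), ENNReal.inv_rpow, ← ENNReal.rpow_neg]
  have : ENNReal.ofReal 2 = 2 := by simp
  rw [this]
  nth_rw 2 [← ENNReal.rpow_one 2]
  rw [← ENNReal.rpow_add _ _ (by simp) (by simp)]
  congr 1; ring

lemma step {m : Measure X} [SigmaFinite m] {K N : ℝ} (A : Amb m K N) {x : X} {τ R : ℝ}
    (hτ : 0 < τ) (hτ1 : τ < 1) {π₁ π₂ : Measure (Geo X)} (h₁ : Good m x τ R π₁)
    (h₂ : Good m x τ R π₂) (s s' : unitInterval) (h0 : 0 < s) (hss : s < s') (h1 : s' < 1)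
    (heq : π₁.map (eval s) = π₂.map (eval s)) (hms : π₁.map (eval s') ⟂ₘ π₂.map (eval s'))
    (κ : ℝ) (hκ : 0 ≤ κ) (hκ1 : κ ≤ 1 - ((s' : ℝ) - s) / s' * Mc K N R)
    (hκ2 : κ ≤ 1 - ((s' : ℝ) - s) / (1 - s) * Mc K N R) (hκ3 : 1 < 2 ^ (1 - pN N) * κ ^ 2) : False := by
  have := h₁.prob
  have := h₂.prob
  have := prob_map π₁ s'
  have := prob_map π₂ s'
  have hmix := h₁.mix h₂
  have hα : ((2⁻¹ : ℝ≥0∞) • (π₁ + π₂)).map (eval s) = π₁.map (eval s) := by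
    rw [mix_map _ _ _ (eval_meas s), ← heq, ← two_smul ℝ≥0∞, smul_smul,
      ENNReal.inv_mul_cancel (by simp) (by simp), one_smul]
  have e1 := hmix.U A hτ hτ1 0 s s' (h0.trans hss) h0.le hss.le
  have e1 := le_trans le_add_self e1
  rw [hα, mix_map _ _ _ (eval_meas s'), Ufun_mix m _ (pN_pos A.hN) _ _ (h₁.ac A hτ hτ1 s')
    (h₂.ac A hτ hτ1 s') hms, Set.Icc.coe_zero, sub_zero] at e1
  have e2 := le_trans le_self_add (h₁.U A hτ hτ1 s s' 1 (hss.trans h1) hss.le h1.le)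
  have e3 := le_trans le_self_add (h₂.U A hτ hτ1 s s' 1 (hss.trans h1) hss.le h1.le)
  rw [← heq] at e3
  rw [Set.Icc.coe_one] at e2 e3
  obtain ⟨ht, hz⟩ := h₁.U_fin A hτ hτ1 s
  set U := Ufun m (pN N) (π₁.map (eval s))
  have f2 := le_trans (mul_le_mul_left (ENNReal.ofReal_le_ofReal hκ2) U) e2
  have f3 := le_trans (mul_le_mul_left (ENNReal.ofReal_le_ofReal hκ2) U) e3
  have : ENNReal.ofReal (2 ^ (1 - pN N) * κ ^ 2) * U ≤ U := by
    calc ENNReal.ofReal (2 ^ (1 - pN N) * κ ^ 2) * U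
        = ENNReal.ofReal κ * ((2⁻¹ : ℝ≥0∞) ^ (pN N) * (ENNReal.ofReal κ * U + ENNReal.ofReal κ * U)) := by
          rw [ENNReal.ofReal_mul (by positivity), ← half_pow, ENNReal.ofReal_pow hκ]
          ring
      _ ≤ _ := by
          refine le_trans ?_ e1
          gcongr
  have h4 : (1 : ℝ≥0∞) < ENNReal.ofReal (2 ^ (1 - pN N) * κ ^ 2) := by
    rw [← ENNReal.ofReal_one]
    exact (ENNReal.ofReal_lt_ofReal_iff (by linarith)).2 hκ3
  have h5 := (ENNReal.mul_lt_mul_iff_left hz ht).2 h4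
  rw [one_mul] at h5
  exact absurd this (not_le.2 h5)

lemma grid {m : Measure X} [SigmaFinite m] {K N : ℝ} (A : Amb m K N) {x : X} {τ R : ℝ}
    (hτ : 0 < τ) (hτ1 : τ < 1) (a : unitInterval) (ha : a < 1) (E₁ E₂ : Set X)
    (hE₁ : MeasurableSet E₁) (hE : Disjoint E₁ E₂)
    (s0 : unitInterval) (hs0 : 0 < s0) (hs0a : s0 ≤ a) {π₁ π₂ : Measure (Geo X)} (h₁ : Good m x τ R π₁)
    (h₂ : Good m x τ R π₂) (hp₁ : ∀ᵐ γ ∂π₁, eval a γ ∈ E₁) (hp₂ : ∀ᵐ γ ∂π₂, eval a γ ∈ E₂) :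
    π₁.map (eval s0) ⟂ₘ π₂.map (eval s0) := by
  have hs0' : (0 : ℝ) < s0 := hs0
  have ha' : (a : ℝ) < 1 := ha
  set c : ℝ := (1 - pN N) / 4 with hc
  have hcpos : 0 < c := by have := pN_lt A.hN; simp only [hc]; linarith
  set κ : ℝ := 2 ^ (-c) with hκ
  have hκ0 : 0 < κ := by positivity
  have hκ1 : κ < 1 := Real.rpow_lt_one_of_one_lt_of_neg (by norm_num) (by linarith)
  have hκ3 : 1 < 2 ^ (1 - pN N) * κ ^ 2 := by
    have : κ ^ 2 = 2 ^ (-(2 * c)) := by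
      rw [hκ, ← Real.rpow_natCast, ← Real.rpow_mul (by norm_num)]
      congr 1; push_cast; ring
    rw [this, ← Real.rpow_add (by norm_num)]
    exact Real.one_lt_rpow (by norm_num) (by simp only [hc] at hcpos ⊢; linarith)
  set M := Mc K N R
  have hM : 1 ≤ M := Mc_ge K N R
  set e : ℝ := min (s0 : ℝ) (1 - a) with he
  have hepos : 0 < e := lt_min hs0' (by linarith)
  set d : ℝ := (1 - κ) * e / M with hd
  have hdpos : 0 < d := by
    have : 0 < 1 - κ := by linarith
    positivity
  have hdM : d * M = (1 - κ) * e := by simp only [hd]; field_simp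
  have key : ∀ n : ℕ, ∀ s : unitInterval, s0 ≤ s → s ≤ a → (a : ℝ) - s ≤ n * d →
      ∀ π₁ π₂ : Measure (Geo X), Good m x τ R π₁ → Good m x τ R π₂ →
      (∀ᵐ γ ∂π₁, eval a γ ∈ E₁) → (∀ᵐ γ ∂π₂, eval a γ ∈ E₂) →
      π₁.map (eval s) ⟂ₘ π₂.map (eval s) := by
    have base : ∀ π₁ π₂ : Measure (Geo X), 
      (∀ᵐ γ ∂π₁, eval a γ ∈ E₁) → (∀ᵐ γ ∂π₂, eval a γ ∈ E₂) →
      π₁.map (eval a) ⟂ₘ π₂.map (eval a) := by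
      intro π₁ π₂ h1 h2
      refine ⟨E₁ᶜ, hE₁.compl, ?_, ?_⟩
      · rw [Measure.map_apply (eval_meas a) hE₁.compl]
        exact h1
      · rw [compl_compl, Measure.map_apply (eval_meas a) hE₁]
        refine measure_mono_null ?_ h2
        intro γ hγ hγ2
        exact (Set.disjoint_left.1 hE) hγ hγ2
    intro n
    induction n with
    | zero =>
      intro s _ hsa hd π₁ π₂ _ _ h1 h2
      have : s = a := le_antisymm hsa (by
        have : (a : ℝ) ≤ s := by simpa using hd
        exact this)
      rw [this]
      exact base π₁ π₂ h1 h2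
    | succ n ih =>
      intro s hs hsa hsd π₁ π₂ g1 g2 h1 h2
      rcases eq_or_lt_of_le hsa with hsa | hsa
      · rw [hsa]; exact base π₁ π₂ h1 h2
      by_contra hns
      have := g1.prob
      have := g2.prob
      have := prob_map π₁ s
      have := prob_map π₂ s
      obtain ⟨l, hl, hl1, hl2⟩ := aux_common _ _ hns
      obtain ⟨ρ₁, p1, q1, r1⟩ := aux_lift π₁ (eval s) (eval_meas s) l hl1
      obtain ⟨ρ₂, p2, q2, r2⟩ := aux_lift π₂ (eval s) (eval_meas s) l hl2
      have k1 := g1.of_ac p1 q1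
      have k2 := g2.of_ac p2 q2
      have hsa' : (s : ℝ) < a := hsa
      have hs' : (s0 : ℝ) ≤ s := hs
      set s' : unitInterval := ⟨min ((s : ℝ) + d) a, le_min (by linarith) (by linarith),
        (min_le_right _ _).trans ha'.le⟩ with hs'd
      have hs'c : (s' : ℝ) = min ((s : ℝ) + d) a := rfl
      have b1 : (s : ℝ) < s' := by rw [hs'c]; exact lt_min (by linarith) hsa'
      have b2 : (s' : ℝ) ≤ a := min_le_right _ _
      have b3 : (s' : ℝ) - s ≤ d := by
        have := min_le_left ((s : ℝ) + d) a
        rw [hs'c]; linarith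
      have b4 : (a : ℝ) - s' ≤ n * d := by
        push_cast at hsd
        rw [hs'c]
        rcases min_cases ((s : ℝ) + d) (a : ℝ) with h | h
        · rw [h.1]; linarith
        · rw [h.1]; simp; positivity
      have hms := ih s' (hs'.trans b1.le) b2 b4 ρ₁ ρ₂ k1 k2 (q1.ae_le h1) (q2.ae_le h2)
      have bound : ∀ D : ℝ, e ≤ D → κ ≤ 1 - ((s' : ℝ) - s) / D * M := by
        intro D hD
        have hDp : 0 < D := by linarith
        have : ((s' : ℝ) - s) / D * M ≤ 1 - κ := by
          rw [div_mul_eq_mul_div, div_le_iff₀ hDp]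
          calc ((s' : ℝ) - s) * M ≤ d * M := by gcongr
            _ = (1 - κ) * e := hdM
            _ ≤ (1 - κ) * D := by gcongr
        linarith
      exact step A hτ hτ1 k1 k2 s s' (hs0.trans_le hs) b1 (lt_of_le_of_lt b2 ha') (r1.trans r2.symm) hms κ
        hκ0.le (bound _ ((min_le_left _ _).trans (by linarith)))
        (bound _ ((min_le_right _ _).trans (by linarith))) hκ3
  obtain ⟨n, hn⟩ := exists_nat_ge (((a : ℝ) - s0) / d)
  exact key n s0 le_rfl hs0a ((div_le_iff₀ hdpos).1 hn) π₁ π₂ h₁ h₂ hp₁ hp₂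

lemma final {m : Measure X} [SigmaFinite m] {K N : ℝ} (A : Amb m K N) {x : X} {τ R : ℝ}
    (hτ : 0 < τ) (hτ1 : τ < 1) (a : unitInterval) (ha : 0 < a) {π₁ π₂ : Measure (Geo X)}
    (h₁ : Good m x τ R π₁) (h₂ : Good m x τ R π₂) (D : Set X) (hD : IsCompact D) (hD0 : m D ≠ 0)
    (hs₁ : π₁.map (eval 0) = (m D)⁻¹ • m.restrict D) (hs₂ : π₂.map (eval 0) = (m D)⁻¹ • m.restrict D)
    (hms : ∀ s : unitInterval, 0 < s → s ≤ a → π₁.map (eval s) ⟂ₘ π₂.map (eval s)) : False := by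
  have := h₁.prob
  have := h₂.prob
  have hmix := h₁.mix h₂
  have := hmix.prob
  have hDm := hD.measurableSet
  have hDt : m D ≠ ⊤ := A.bdd D hD.isBounded
  have hpl := pN_lt A.hN
  set M := Mc K N R
  have hR : 0 ≤ R := by
    obtain ⟨γ, hγ⟩ := (h₁.pt).exists
    exact dist_nonneg.trans hγ.1
  set sq : ℕ → unitInterval := fun n => ⟨a / (n + 1), by have := a.2.1; positivity, by
    have := a.2.2
    rw [div_le_one (by positivity)]
    have : (0 : ℝ) ≤ n := by positivity
    linarith⟩ with hsq
  have ha' : (0 : ℝ) < a := ha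
  have hsc : ∀ n, (sq n : ℝ) = a / (n + 1) := fun n => rfl
  have hspos : ∀ n, (0 : ℝ) < sq n := fun n => by rw [hsc]; positivity
  have hsle : ∀ n, (sq n : ℝ) ≤ a := fun n => by
    rw [hsc]; apply div_le_self ha'.le; have : (0 : ℝ) ≤ n := by positivity
    linarith
  have hst : Filter.Tendsto (fun n => (sq n : ℝ)) Filter.atTop (nhds 0) := by
    have := (tendsto_one_div_add_atTop_nhds_zero_nat (𝕜 := ℝ)).const_mul (a : ℝ)
    simpa [hsc, div_eq_mul_inv] using this
  have ineq : ∀ n, ENNReal.ofReal (2 ^ (1 - pN N) * (1 - sq n * M)) * (m D) ^ (1 - pN N) ≤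
      (m (cthickening (sq n * R) D)) ^ (1 - pN N) := by
    intro n
    set s := sq n
    have := prob_map π₁ s
    have := prob_map π₂ s
    have := prob_map ((2⁻¹ : ℝ≥0∞) • (π₁ + π₂)) s
    have e1 := le_trans le_self_add (h₁.U A hτ hτ1 0 s 1 (by simp) s.2.1 s.2.2)
    have e2 := le_trans le_self_add (h₂.U A hτ hτ1 0 s 1 (by simp) s.2.1 s.2.2)
    rw [hs₁, Ufun_unif m _ (pN_pos A.hN) D hDm hD0 hDt] at e1
    rw [hs₂, Ufun_unif m _ (pN_pos A.hN) D hDm hD0 hDt] at e2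
    simp only [Set.Icc.coe_zero, Set.Icc.coe_one, sub_zero, div_one] at e1 e2
    have e3 := Ufun_mix m _ (pN_pos A.hN) _ _ (h₁.ac A hτ hτ1 s)
      (h₂.ac A hτ hτ1 s) (hms s (hspos n) (hsle n))
    rw [← mix_map _ _ _ (eval_meas s)] at e3
    have e4 := Ufun_le m (pN N) (pN_pos A.hN) (pN_lt A.hN) _ (hmix.ac A hτ hτ1 s)
      (cthickening (s * R) D) isClosed_cthickening.measurableSet (by
        rw [Measure.map_apply (eval_meas s) isClosed_cthickening.measurableSet.compl]
        have k0 : ∀ᵐ γ ∂((2⁻¹ : ℝ≥0∞) • (π₁ + π₂)), eval 0 γ ∈ D := by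
          refine Measure.ae_smul_measure ?_ _
          rw [ae_add_measure_iff]
          have : ∀ᵐ y ∂((m D)⁻¹ • m.restrict D), y ∈ D :=
            Measure.ae_smul_measure (ae_restrict_mem hDm) _
          constructor
          · exact ae_of_ae_map (eval_meas 0).aemeasurable (by rw [hs₁]; exact this)
          · exact ae_of_ae_map (eval_meas 0).aemeasurable (by rw [hs₂]; exact this)
        have : ∀ᵐ γ ∂((2⁻¹ : ℝ≥0∞) • (π₁ + π₂)), eval s γ ∈ cthickening (s * R) D := by
          filter_upwards [k0, hmix.pt] with γ k1 k2
          refine mem_cthickening_of_dist_le _ _ _ _ k1 ?_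
          rw [Geo.dist_eval, k2.2.1, Set.Icc.coe_zero, sub_zero, abs_of_nonneg s.2.1]
          have h0 : 0 ≤ dist (eval 0 γ) x := dist_nonneg
          have : τ * dist (eval 0 γ) x ≤ R := by nlinarith [k2.1]
          exact mul_le_mul_of_nonneg_left this s.2.1
        exact this)
    refine le_trans ?_ e4
    rw [e3, ENNReal.ofReal_mul (by positivity), ← half_pow]
    calc _ = (2⁻¹ : ℝ≥0∞) ^ (pN N) * (ENNReal.ofReal (1 - s * M) * (m D) ^ (1 - pN N) +
          ENNReal.ofReal (1 - s * M) * (m D) ^ (1 - pN N)) := by ring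
      _ ≤ _ := by gcongr
  have hlimit : Filter.Tendsto (fun n => (m (cthickening (sq n * R) D)) ^ (1 - pN N)) Filter.atTop
      (nhds ((m D) ^ (1 - pN N))) := by
    refine (ENNReal.continuous_rpow_const.tendsto _).comp ?_
    have h1 : Filter.Tendsto (fun r => m (cthickening r D)) (nhds 0) (nhds (m D)) :=
      tendsto_measure_cthickening_of_isClosed
        ⟨1, one_pos, A.bdd _ hD.isBounded.cthickening⟩ hD.isClosed
    have h2 : Filter.Tendsto (fun n => (sq n : ℝ) * R) Filter.atTop (nhds 0) := by
      simpa using hst.mul_const R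
    exact h1.comp h2
  have hlimit2 : Filter.Tendsto (fun n => ENNReal.ofReal (2 ^ (1 - pN N) * (1 - sq n * M)) * (m D) ^ (1 - pN N))
      Filter.atTop (nhds (ENNReal.ofReal (2 ^ (1 - pN N) * (1 - 0 * M)) * (m D) ^ (1 - pN N))) := by
    refine ENNReal.Tendsto.mul_const ?_ (Or.inr (ENNReal.rpow_ne_top_of_nonneg (by linarith) hDt))
    refine (ENNReal.continuous_ofReal.tendsto _).comp ?_
    exact ((hst.mul_const M).const_sub 1).const_mul _
  have hle := le_of_tendsto_of_tendsto' hlimit2 hlimit ineq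
  have h4 : (1 : ℝ≥0∞) < ENNReal.ofReal (2 ^ (1 - pN N) * (1 - 0 * M)) := by
    have : (1 : ℝ) < 2 ^ (1 - pN N) := Real.one_lt_rpow (by norm_num) (by linarith)
    rw [← ENNReal.ofReal_one]
    exact (ENNReal.ofReal_lt_ofReal_iff (by linarith)).2 (by linarith)
  have h5 := (ENNReal.mul_lt_mul_iff_left (c := (m D) ^ (1 - pN N))
    (by simp [ENNReal.rpow_eq_zero_iff, hD0, hDt]) (ENNReal.rpow_ne_top_of_nonneg (by linarith) hDt)).2 h4
  rw [one_mul] at h5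
  exact absurd hle (not_le.2 h5)

end fin

section core
variable {X : Type*} [MetricSpace X] [MeasurableSpace X] [BorelSpace X] [SecondCountableTopology X]

/-- Geodesics pointing to `x` ending near `q`. -/
def Gs (x : X) (τ R : ℝ) (q : X) (r : ℝ) : Set (Geo X) := {γ | Pt x τ R γ ∧ dist (eval 1 γ) q ≤ r}

/-- Starting points of such. -/
def Ps (x : X) (τ R : ℝ) (q : X) (r : ℝ) : Set X :=
  {y | ∃ γ ∈ Gs x τ R q r, (y, γ) ∈ {z : X × Geo X | eval 0 z.2 = z.1}}

lemma C_closed : IsClosed {z : X × Geo X | eval 0 z.2 = z.1} :=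
  isClosed_eq ((Geo.continuous_eval 0).comp continuous_snd) continuous_fst

lemma Gs_compact [ProperSpace X] (x : X) (τ R : ℝ) (hτ : 0 < τ) (hτ1 : τ < 1) (q : X) (r : ℝ) :
    IsCompact (Gs x τ R q r) := by
  have h1 := Geo.continuous_eval (X := X) 1
  refine (geo_compact x R).of_isClosed_subset ?_ ?_
  · exact (Pt_closed x τ R).inter (isClosed_le (by fun_prop) (by fun_prop) :
      IsClosed {γ : Geo X | dist (eval 1 γ) q ≤ r})
  · intro γ hγ
    refine ⟨hγ.1.1, ?_⟩
    rw [hγ.1.2.1]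
    have h0 : 0 ≤ dist (eval 0 γ) x := dist_nonneg
    nlinarith [hγ.1.1]

lemma Ps_closed [ProperSpace X] (x : X) (τ R : ℝ) (hτ : 0 < τ) (hτ1 : τ < 1) (q : X) (r : ℝ) :
    IsClosed (Ps x τ R q r) :=
  closed_proj _ C_closed _ (Gs_compact x τ R hτ hτ1 q r)

lemma init [ProperSpace X] {m : Measure X} [SigmaFinite m] {K N : ℝ} (A : Amb m K N) {x : X} {τ R : ℝ}
    (hτ : 0 < τ) (hτ1 : τ < 1) (q : X) (r : ℝ) (μ : Measure X) [IsProbabilityMeasure μ] (hμ : μ ≪ m)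
    (hP : ∀ᵐ y ∂μ, y ∈ Ps x τ R q r) (t : unitInterval) (ht : t < 1)
    (htr : (1 - (t : ℝ) * t) * R < r) :
    ∃ π : Measure (Geo X), Good m x (t * τ) R π ∧ π.map (eval 0) ≪ μ ∧
      ∀ᵐ γ ∂π, eval t γ ∈ ball q (2 * r) := by
  obtain ⟨y0, γ0, -⟩ := hP.exists
  have : Nonempty (Geo X) := ⟨γ0⟩
  obtain ⟨f, hf, hfP⟩ := selection _ C_closed (Gs x τ R q r) (Gs_compact x τ R hτ hτ1 q r)
  set π0 := μ.map f with hπ0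
  have hp0 : IsProbabilityMeasure π0 := Measure.isProbabilityMeasure_map hf.aemeasurable
  have hf0 : ∀ᵐ y ∂μ, f y ∈ Gs x τ R q r ∧ eval 0 (f y) = y := by
    filter_upwards [hP] with y hy using hfP y hy
  have hG0 : ∀ᵐ γ ∂π0, γ ∈ Gs x τ R q r := by
    refine (ae_map_iff (p := fun γ => γ ∈ Gs x τ R q r) hf.aemeasurable
      (Gs_compact x τ R hτ hτ1 q r).measurableSet).2 ?_
    filter_upwards [hf0] with y hy using hy.1
  have he0 : π0.map (eval 0) = μ := by
    rw [hπ0, Measure.map_map (eval_meas 0) hf]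
    conv_rhs => rw [← Measure.map_id (μ := μ)]
    refine Measure.map_congr ?_
    filter_upwards [hf0] with y hy using hy.2
  have hpt0 : ∀ᵐ γ ∂π0, Pt x τ R γ := by filter_upwards [hG0] with γ hγ using hγ.1
  have n0 : (π0.map (eval 0)) (closedBall x R)ᶜ = 0 := by
    rw [Measure.map_apply (eval_meas 0) measurableSet_closedBall.compl]
    exact (by filter_upwards [hpt0] with γ hγ using hγ.1 : ∀ᵐ γ ∂π0, dist (eval 0 γ) x ≤ R)
  have n1 : (π0.map (eval 1)) (closedBall x R)ᶜ = 0 := by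
    rw [Measure.map_apply (eval_meas 1) measurableSet_closedBall.compl]
    have : ∀ᵐ γ ∂π0, dist (eval 1 γ) x ≤ R := by
      filter_upwards [hpt0] with γ hγ
      rw [hγ.2.2]
      have : 0 ≤ dist (eval 0 γ) x := dist_nonneg
      nlinarith [hγ.1]
    exact this
  obtain ⟨π, hopt, hineq⟩ := A.cd _ _ (prob_map π0 0) (prob_map π0 1)
    ⟨closedBall x R, isBounded_closedBall, n0, n1⟩
  have hpt := Pt_of_opt hτ hτ1 hpt0 hopt
  have hπp := hopt.1
  have hπ0m : π.map (eval 0) = μ := hopt.2.1.trans he0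
  have hend : ∀ᵐ γ ∂π, dist (eval 1 γ) q ≤ r := by
    have h1 : ∀ᵐ z ∂(π0.map (eval 1)), z ∈ closedBall q r := by
      refine (ae_map_iff (p := fun z => z ∈ closedBall q r) (eval_meas 1).aemeasurable
        measurableSet_closedBall).2 ?_
      filter_upwards [hG0] with γ hγ using hγ.2
    rw [← hopt.2.2.1] at h1
    exact ae_of_ae_map (eval_meas 1).aemeasurable h1
  have hns := cd_pos m K N (by linarith [A.hN]) π (by rw [hπ0m]; exact hμ) t ht
    (hineq t (N + 1) (by linarith))
  have := prob_map π t
  obtain ⟨l, hl, hl1, hl2⟩ := aux_common _ _ hns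
  obtain ⟨ρ, p1, q1, r1⟩ := aux_lift π (eval t) (eval_meas t) l hl1
  have hmap : ∀ u, (ρ.map (seg 0 t)).map (eval u) = ρ.map (eval (cvI 0 t u)) := by
    intro u
    rw [Measure.map_map (eval_meas u) (seg_meas 0 t)]
    rfl
  have hρ0 : ρ.map (eval 0) ≪ μ := by
    rw [← hπ0m]; exact q1.map (eval_meas 0)
  refine ⟨ρ.map (seg 0 t), ⟨Measure.isProbabilityMeasure_map (seg_meas 0 t).aemeasurable, ?_, ?_, ?_⟩, ?_, ?_⟩
  · rw [hmap, cvI_zero]; exact hρ0.trans hμ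
  · rw [hmap, cvI_one, r1]; exact hl2
  · rw [ae_map_iff (seg_meas 0 t).aemeasurable (Pt_closed _ _ _).measurableSet]
    filter_upwards [q1.ae_le hpt] with γ hγ
    have := hγ.seg hτ hτ1 0 t t.2.1
    simpa using this
  · rw [hmap, cvI_zero]; exact hρ0
  · rw [ae_map_iff (seg_meas 0 t).aemeasurable (isOpen_ball.preimage (Geo.continuous_eval t)).measurableSet]
    filter_upwards [q1.ae_le hpt, q1.ae_le hend] with γ hγ hγ1
    rw [eval_seg, mem_ball]
    have h1 := Geo.dist_eval γ (cvI 0 t t) 1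
    have h2 := dist_triangle (eval (cvI 0 t t) γ) (eval 1 γ) q
    rw [cvI_coe, hγ.2.1, Set.Icc.coe_zero, Set.Icc.coe_one, mul_zero, zero_add] at h1
    have ht0 := t.2.1
    have ht1 := t.2.2
    rw [abs_of_nonpos (by nlinarith)] at h1
    have h0 : 0 ≤ dist (eval 0 γ) x := dist_nonneg
    have h3 : τ * dist (eval 0 γ) x ≤ R := by nlinarith [hγ.1]
    have h4 : -((t : ℝ) * t - 1) * (τ * dist (eval 0 γ) x) ≤ -((t : ℝ) * t - 1) * R :=
      mul_le_mul_of_nonneg_left h3 (by nlinarith)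
    linarith

lemma unif_prob (m : Measure X) (D : Set X) (h0 : m D ≠ 0) (ht : m D ≠ ⊤) :
    IsProbabilityMeasure ((m D)⁻¹ • m.restrict D) := by
  constructor
  simp only [Measure.smul_apply, Measure.restrict_apply_univ, smul_eq_mul]
  exact ENNReal.inv_mul_cancel h0 ht

lemma core [ProperSpace X] {m : Measure X} [SigmaFinite m] [IsFiniteMeasureOnCompacts m] {K N : ℝ}
    (A : Amb m K N) (x : X) (τ R : ℝ) (hτ : 0 < τ) (hτ1 : τ < 1) (q₁ q₂ : X) (r : ℝ) (hr : 0 < r)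
    (hq : 4 * r ≤ dist q₁ q₂) :
    m (Ps x τ R q₁ r ∩ Ps x τ R q₂ r) = 0 := by
  by_contra hne
  set P := Ps x τ R q₁ r ∩ Ps x τ R q₂ r with hPd
  have hPm : MeasurableSet P :=
    ((Ps_closed x τ R hτ hτ1 q₁ r).inter (Ps_closed x τ R hτ hτ1 q₂ r)).measurableSet
  have hPb : Bornology.IsBounded P := by
    refine (isBounded_closedBall (x := x) (r := R)).subset ?_
    rintro y ⟨⟨γ, hγ, he⟩, -⟩
    have he : eval 0 γ = y := he
    rw [mem_closedBall, ← he]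
    exact hγ.1.1
  have hPt := A.bdd P hPb
  obtain ⟨η, hη0, hη1, hηr⟩ : ∃ η : ℝ, 0 < η ∧ η < 1 ∧ 2 * η * |R| < r := by
    refine ⟨min (1/2) (r / (4 * (|R| + 1))), ?_, ?_, ?_⟩
    · have : 0 ≤ |R| := abs_nonneg R
      exact lt_min (by norm_num) (by positivity)
    · exact lt_of_le_of_lt (min_le_left _ _) (by norm_num)
    · have h0 : 0 ≤ |R| := abs_nonneg R
      have h1 : 2 * min (1/2) (r / (4 * (|R| + 1))) * |R| ≤ 2 * (r / (4 * (|R| + 1))) * |R| := by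
        gcongr
        exact min_le_right _ _
      refine lt_of_le_of_lt h1 ?_
      rw [show 2 * (r / (4 * (|R| + 1))) * |R| = (2 * r * |R|) / (4 * (|R| + 1)) by ring,
        div_lt_iff₀ (by positivity)]
      nlinarith [mul_nonneg hr.le h0]
  set t : unitInterval := ⟨1 - η, by linarith, by linarith⟩ with htd
  have htc : (t : ℝ) = 1 - η := rfl
  have ht1 : t < 1 := by
    change (t : ℝ) < 1
    rw [htc]; linarith
  have ht0 : 0 < t := by
    change (0 : ℝ) < t
    rw [htc]; linarith
  have ht0' : (0 : ℝ) < t := ht0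
  have htr : (1 - (t : ℝ) * t) * R < r := by
    rw [htc]
    have h1 := le_abs_self R
    have h2 : (1 - (1 - η) * (1 - η)) * R ≤ (1 - (1 - η) * (1 - η)) * |R| :=
      mul_le_mul_of_nonneg_left h1 (by nlinarith)
    have h3 : (1 - (1 - η) * (1 - η)) * |R| ≤ 2 * η * |R| :=
      mul_le_mul_of_nonneg_right (by nlinarith) (abs_nonneg R)
    linarith
  have hp := unif_prob m P hne hPt
  set μ := (m P)⁻¹ • m.restrict P with hμd
  have hμm : μ ≪ m := Measure.smul_absolutelyContinuous.trans Measure.restrict_le_self.absolutelyContinuous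
  have hμP : ∀ᵐ y ∂μ, y ∈ P := Measure.ae_smul_measure (ae_restrict_mem hPm) _
  obtain ⟨π₁, g1, a1, b1⟩ := init A hτ hτ1 q₁ r μ hμm (hμP.mono fun y hy => hy.1) t ht1 htr
  have := g1.prob
  have := prob_map π₁ 0
  obtain ⟨π₂, g2, a2, b2⟩ := init A hτ hτ1 q₂ r (π₁.map (eval 0)) (a1.trans hμm)
    (a1.ae_le (hμP.mono fun y hy => hy.2)) t ht1 htr
  have := g2.prob
  have := prob_map π₂ 0
  set ν := π₂.map (eval 0) with hν
  have hνm : ν ≪ m := g2.ac0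
  have hνP : ν Pᶜ = 0 := (a2.trans a1).ae_le hμP
  set S : Set X := {y | ν.rnDeriv m y ≠ 0} with hS
  have hSm : MeasurableSet S :=
    (measurableSet_eq_fun (Measure.measurable_rnDeriv ν m) measurable_const).compl
  have hνS : ν Sᶜ = 0 := by
    rw [← Measure.setLIntegral_rnDeriv hνm, lintegral_eq_zero_iff (Measure.measurable_rnDeriv ν m)]
    filter_upwards [ae_restrict_mem hSm.compl] with y hy
    simpa [hS] using hy
  have hSP : m (S ∩ P) ≠ 0 := by
    intro h0
    have h1 := hνm h0
    have h2 : ν univ = 0 := by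
      refine measure_mono_null (t := (S ∩ P) ∪ (Sᶜ ∪ Pᶜ)) ?_
        (measure_union_null h1 (measure_union_null hνS hνP))
      intro y _
      by_cases h3 : y ∈ S <;> by_cases h4 : y ∈ P <;> simp [h3, h4]
    simp at h2
  obtain ⟨D, hDS, hDc, hD0⟩ := (hSm.inter hPm).exists_lt_isCompact_of_ne_top
    (A.bdd _ (hPb.subset inter_subset_right)) (pos_iff_ne_zero.2 hSP)
  have hD0 := hD0.ne'
  have hlp := unif_prob m D hD0 (A.bdd D hDc.isBounded)
  set l := (m D)⁻¹ • m.restrict D with hl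
  have hlν : l ≪ ν := by
    refine Measure.smul_absolutelyContinuous.trans ?_
    refine Measure.AbsolutelyContinuous.mk fun Z hZ hνZ => ?_
    have h1 := aux_zero_of_null m ν hνm Z hZ hνZ
    rw [Measure.restrict_apply hZ]
    refine measure_mono_null ?_ h1
    intro y hy h2
    exact (hDS hy.2).1 (h2 hy.1)
  obtain ⟨ρ₁, p1, c1, e1⟩ := aux_lift π₁ (eval 0) (eval_meas 0) l (hlν.trans a2)
  obtain ⟨ρ₂, p2, c2, e2⟩ := aux_lift π₂ (eval 0) (eval_meas 0) l hlν
  have k1 := g1.of_ac p1 c1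
  have k2 := g2.of_ac p2 c2
  have hT : 0 < (t : ℝ) * τ := by positivity
  have hT1 : (t : ℝ) * τ < 1 := by nlinarith [t.2.2]
  have hdisj : Disjoint (ball q₁ (2 * r)) (ball q₂ (2 * r)) := ball_disjoint_ball (by linarith)
  exact final A hT hT1 t ht0 k1 k2 D hDc hD0 e1 e2 fun s hs hst =>
    grid A hT hT1 t ht1 _ _ isOpen_ball.measurableSet hdisj s hs hst k1 k2 (c1.ae_le b1) (c2.ae_le b2)

lemma main_uniq [ProperSpace X] {m : Measure X} [SigmaFinite m] [IsFiniteMeasureOnCompacts m] {K N : ℝ}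
    (A : Amb m K N) (x : X) :
    ∀ᵐ y ∂m, ∀ γ₁ γ₂ : Geo X, eval 0 γ₁ = y → eval 1 γ₁ = x → eval 0 γ₂ = y → eval 1 γ₂ = x → γ₁ = γ₂ := by
  have : Nonempty X := ⟨x⟩
  have key : ∀ᵐ y ∂m, ∀ n i j k R : ℕ,
      0 < ((TopologicalSpace.denseSeq unitInterval n : unitInterval) : ℝ) →
      ((TopologicalSpace.denseSeq unitInterval n : unitInterval) : ℝ) < 1 →
      4 * (1 / ((k : ℝ) + 1)) ≤ dist (TopologicalSpace.denseSeq X i) (TopologicalSpace.denseSeq X j) →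
      y ∉ Ps x (TopologicalSpace.denseSeq unitInterval n : unitInterval) R (TopologicalSpace.denseSeq X i) (1 / ((k : ℝ) + 1))
        ∩ Ps x (TopologicalSpace.denseSeq unitInterval n : unitInterval) R (TopologicalSpace.denseSeq X j) (1 / ((k : ℝ) + 1)) := by
    simp only [ae_all_iff]
    intro n i j k R h0 h1 h2
    exact measure_eq_zero_iff_ae_notMem.1 (core A x _ R h0 h1 _ _ _ (by positivity) h2)
  filter_upwards [key] with y hy γ₁ γ₂ a0 a1 b0 b1
  by_contra hne
  have hne' : ∃ u : unitInterval, eval u γ₁ ≠ eval u γ₂ := by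
    by_contra! h
    exact hne (Subtype.ext (ContinuousMap.ext h))
  have hopen : IsOpen {u : unitInterval | eval u γ₁ ≠ eval u γ₂} :=
    isOpen_ne_fun γ₁.1.continuous γ₂.1.continuous
  obtain ⟨n, hn⟩ := (TopologicalSpace.denseRange_denseSeq unitInterval).exists_mem_open hopen hne'
  set t := TopologicalSpace.denseSeq unitInterval n
  have hn : eval t γ₁ ≠ eval t γ₂ := hn
  have ht0 : 0 < (t : ℝ) := by
    refine lt_of_le_of_ne t.2.1 fun h => hn ?_
    have : t = 0 := Subtype.ext h.symm
    rw [this, a0, b0]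
  have ht1 : (t : ℝ) < 1 := by
    refine lt_of_le_of_ne t.2.2 fun h => hn ?_
    have : t = 1 := Subtype.ext h
    rw [this, a1, b1]
  have hδ := dist_pos.2 hn
  obtain ⟨k, hk⟩ := exists_nat_one_div_lt (show (0 : ℝ) < dist (eval t γ₁) (eval t γ₂) / 6 by positivity)
  set r : ℝ := 1 / ((k : ℝ) + 1) with hr
  have hrpos : 0 < r := by positivity
  obtain ⟨i, hi⟩ := (TopologicalSpace.denseRange_denseSeq X).exists_dist_lt (eval t γ₁) hrpos
  obtain ⟨j, hj⟩ := (TopologicalSpace.denseRange_denseSeq X).exists_dist_lt (eval t γ₂) hrpos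
  obtain ⟨R, hR⟩ := exists_nat_ge (dist y x)
  have mem : ∀ γ : Geo X, eval 0 γ = y → eval 1 γ = x → ∀ q, dist (eval t γ) q < r →
      y ∈ Ps x t R q r := by
    intro γ c0 c1 q hq
    refine ⟨seg 0 t γ, ⟨⟨?_, ?_, ?_⟩, ?_⟩, ?_⟩
    · rw [eval_seg_zero, c0]; exact hR
    · rw [eval_seg_zero, eval_seg_one, Geo.dist_eval, c0, c1]
      simp [abs_of_pos ht0]
    · rw [eval_seg_zero, eval_seg_one, ← c1, Geo.dist_eval, c1, c0, Set.Icc.coe_one, abs_of_neg (by linarith)]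
      ring
    · rw [eval_seg_one]; exact hq.le
    · change eval 0 (seg 0 t γ) = y
      rw [eval_seg_zero, c0]
  refine hy n i j k R ht0 ht1 ?_ ⟨mem γ₁ a0 a1 _ hi, mem γ₂ b0 b1 _ hj⟩
  have t1 := dist_triangle4 (eval t γ₁) (TopologicalSpace.denseSeq X i) (TopologicalSpace.denseSeq X j) (eval t γ₂)
  rw [dist_comm (TopologicalSpace.denseSeq X j)] at t1
  linarith

lemma main_all [ProperSpace X] (hX : IsGeodesicSpace X) (m : Measure X)
    (hm_bdd : ∀ s : Set X, Bornology.IsBounded s → m s ≠ ⊤)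
    (K N : ℝ) (hN : 1 ≤ N) (hCD : IsCDStar K N m) (hGT : GoodTransport m) (x : X) :
    ∀ᵐ y ∂m, ∃! γ : Geo X, eval 0 γ = y ∧ eval 1 γ = x := by
  have : IsFiniteMeasureOnCompacts m := ⟨fun s hs => (hm_bdd s hs.isBounded).lt_top⟩
  have : SigmaFinite m := inferInstance
  filter_upwards [main_uniq ⟨hm_bdd, hN, hCD, hGT⟩ x] with y hy
  obtain ⟨γ, h0, h1⟩ := hX y x
  exact ⟨γ, ⟨h0, h1⟩, fun γ' h' => hy γ' γ h'.1 h'.2 h0 h1⟩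

end core

/-- **Corollary 1.4**: on a `CD*(K,N)` space with the good transport property, for every
`x ∈ X` and `m`-a.e. `y` there is exactly one geodesic from `y` to `x`. -/
theorem unique_geodesic_to_point
    [CompleteSpace X] [TopologicalSpace.SeparableSpace X] [ProperSpace X] [BorelSpace X]
    (hX : IsGeodesicSpace X) (m : Measure X)
    (hm_bdd : ∀ s : Set X, Bornology.IsBounded s → m s ≠ ⊤)
    (hm_supp : ∀ x : X, ∀ r : ℝ, 0 < r → 0 < m (ball x r))
    (K N : ℝ) (hN : 1 ≤ N) (hCD : IsCDStar K N m) (hGT : GoodTransport m)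
    (x : X) :
    ∀ᵐ y ∂m, ∃! γ : Geo X, eval 0 γ = y ∧ eval 1 γ = x := by
  have : SecondCountableTopology X := inferInstance
  exact main_all hX m hm_bdd K N hN hCD hGT x

end
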